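/- Let q = p^h with p prime and h ≥ 1. There exist real constants A > 0 and ε > 0 such that for every function k : ℕ → ℕ satisfying k(n) ≤ n for all n and lim_{n→∞} ( n²/4 − ε·n + A·√n − k(n)·(n − k(n)) ) = −∞ (condition (⋆)), each of the three ratios N^S_{k(2m+1),2m+1}/N^S_{2m+1}, N^M_{k(2m+1),2m+1}/N^M_{2m+1}, and N^Γ_{k(2m+1),2m+1}/N^Γ_{2m+1} is asymptotically equivalent, as m → ∞, to q^{−(m − k(2m+1) + 1/2)²} / θ₂(q^{−1}). -/

import Mathlib

open Filter Matrix
open scoped Topology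

/-- The `q`-binomial coefficient `binom(n,k)_q = ∏_{j=0}^{k-1} (q^{n-j}-1)/(q^{k-j}-1)`. -/
noncomputable def qBinom (q n k : ℕ) : ℝ :=
  ∏ j ∈ Finset.range k, ((q : ℝ) ^ (n - j) - 1) / ((q : ℝ) ^ (k - j) - 1)

/-- `S(n) = ∑_{k=0}^n binom(n,k)_q`. -/
noncomputable def Sq (q n : ℕ) : ℝ := ∑ k ∈ Finset.range (n + 1), qBinom q n k

/-- `K_q = ∏_{j=1}^∞ (1 - q^{-j})`. -/
noncomputable def Kq (q : ℕ) : ℝ := ∏' j : ℕ, (1 - ((q : ℝ))⁻¹ ^ (j + 1))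

/-- `K_q(k) = ∏_{j=1}^{k} (1 - q^{-j})`. -/
noncomputable def KqTrunc (q k : ℕ) : ℝ := ∏ j ∈ Finset.range k, (1 - ((q : ℝ))⁻¹ ^ (j + 1))

/-- Jacobi theta constant `θ₂(w) = ∑_{k∈ℤ} w^{(k+1/2)²}`. -/
noncomputable def theta2 (w : ℝ) : ℝ := ∑' k : ℤ, w ^ (((k : ℝ) + 1/2) ^ 2)

/-- Jacobi theta constant `θ₃(w) = ∑_{k∈ℤ} w^{k²}`. -/
noncomputable def theta3 (w : ℝ) : ℝ := ∑' k : ℤ, w ^ ((k : ℝ) ^ 2)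

/-- Condition (⋆): `n²/4 − ε·n + A·√n − k(n)(n−k(n)) → −∞`. -/
def StarCond (A ε : ℝ) (k : ℕ → ℕ) : Prop :=
  Tendsto (fun n : ℕ =>
    (n : ℝ) ^ 2 / 4 - ε * n + A * Real.sqrt n - (k n : ℝ) * ((n : ℝ) - (k n : ℝ)))
    atTop atBot

/-- The set of permutation matrices inside `GL n F`. -/
def permSet (F : Type) [Field F] (n : ℕ) : Set (GL (Fin n) F) :=
  {M | ∃ σ : Equiv.Perm (Fin n), (M : Matrix (Fin n) (Fin n) F) = σ.permMatrix F}

/-- The set of invertible diagonal matrices inside `GL n F`. -/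
def diagSet (F : Type) [Field F] (n : ℕ) : Set (GL (Fin n) F) :=
  {M | ∃ d : Fin n → F, (M : Matrix (Fin n) (Fin n) F) = Matrix.diagonal d}

/-- The permutation group: subgroup of `GL n F` formed by the permutation matrices. -/
def PermGroup (F : Type) [Field F] (n : ℕ) : Subgroup (GL (Fin n) F) :=
  Subgroup.closure (permSet F n)

/-- The monomial group: subgroup of `GL n F` generated by permutation and diagonal matrices. -/
def MonomialGroup (F : Type) [Field F] (n : ℕ) : Subgroup (GL (Fin n) F) :=
  Subgroup.closure (permSet F n ∪ diagSet F n)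

/-- Number of orbits of a subgroup `G ≤ GL n F` acting on the Grassmannian of
`k`-dimensional subspaces of `F^n` (by taking images of subspaces). -/
noncomputable def numClassesDim {n : ℕ} (F : Type) [Field F]
    (G : Subgroup (GL (Fin n) F)) (k : ℕ) : ℕ :=
  Nat.card (Quot (fun V W : {V : Submodule F (Fin n → F) // Module.finrank F V = k} =>
    ∃ M ∈ G, Submodule.map (Matrix.toLin' (M : Matrix (Fin n) (Fin n) F)) V.1 = W.1))

/-- Number of orbits of a subgroup `G ≤ GL n F` acting on the set of all subspaces of `F^n`. -/
noncomputable def numClasses {n : ℕ} (F : Type) [Field F]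
    (G : Subgroup (GL (Fin n) F)) : ℕ :=
  Nat.card (Quot (fun V W : Submodule F (Fin n → F) =>
    ∃ M ∈ G, Submodule.map (Matrix.toLin' (M : Matrix (Fin n) (Fin n) F)) V = W))

/-- Semilinear orbit relation: `W` is the image of `V` under the semilinear transformation
given by applying the field automorphism `σ` componentwise followed by a monomial matrix. -/
def semiRel (F : Type) [Field F] (n : ℕ) (V W : Submodule F (Fin n → F)) : Prop :=
  ∃ σ : F ≃+* F, ∃ M ∈ MonomialGroup F n,
    (W : Set (Fin n → F)) =
      (fun x => Matrix.mulVec (M : Matrix (Fin n) (Fin n) F) (fun i => σ (x i))) '' (V : Set (Fin n → F))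

/-- Number of semilinear equivalence classes of `k`-dimensional subspaces of `F^n`. -/
noncomputable def numClassesDimSemi (F : Type) [Field F] (n k : ℕ) : ℕ :=
  Nat.card (Quot (fun V W : {V : Submodule F (Fin n → F) // Module.finrank F V = k} =>
    semiRel F n V.1 W.1))

/-- Number of semilinear equivalence classes of subspaces of `F^n`. -/
noncomputable def numClassesSemi (F : Type) [Field F] (n : ℕ) : ℕ :=
  Nat.card (Quot (fun V W : Submodule F (Fin n → F) => semiRel F n V W))

section SubspaceCount

variable {F V : Type} [Field F] [Fintype F] [AddCommGroup V] [Module F V] [Finite V]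

local notation "q" => Fintype.card F

lemma one_lt_cast_card (F : Type) [Field F] [Fintype F] : (1 : ℝ) < (Fintype.card F : ℝ) := by
  exact_mod_cast Fintype.one_lt_card

/-- Linearly independent `k`-tuples are bases of their spans. -/
noncomputable def sigmaEquivLinearIndependent (F V : Type) [Field F] [AddCommGroup V] [Module F V]
    [Module.Finite F V] (k : ℕ) :
    (Σ W : {W : Submodule F V // Module.finrank F W = k},
        {s : Fin k → W.1 // LinearIndependent F s}) ≃
      {s : Fin k → V // LinearIndependent F s} :=
  Equiv.ofBijective
    (fun x => ⟨fun i => (x.2.1 i : V), x.2.2.map' x.1.1.subtype (Submodule.ker_subtype _)⟩) <| by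
  have hspan (W : Submodule F V) (hW : Module.finrank F W = k) (s : Fin k → W)
      (hs : LinearIndependent F s) : Submodule.span F (Set.range fun i => (s i : V)) = W := by
    apply Submodule.eq_of_le_of_finrank_eq
    · rw [Submodule.span_le]
      rintro _ ⟨i, rfl⟩
      exact (s i).2
    · have := finrank_span_eq_card (hs.map' W.subtype (Submodule.ker_subtype _))
      rw [Fintype.card_fin] at this
      rw [hW]
      exact this
  constructor
  · rintro ⟨⟨W, hW⟩, ⟨s, hs⟩⟩ ⟨⟨W', hW'⟩, ⟨s', hs'⟩⟩ h
    have h' : (fun i => (s i : V)) = fun i => (s' i : V) := congrArg Subtype.val h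
    obtain rfl : W = W' := by rw [← hspan W hW s hs, ← hspan W' hW' s' hs', h']
    obtain rfl : s = s' := funext fun i => Subtype.ext (congrFun h' i)
    rfl
  · rintro ⟨s, hs⟩
    refine ⟨⟨⟨Submodule.span F (Set.range s), by rw [finrank_span_eq_card hs, Fintype.card_fin]⟩,
      ⟨fun i => ⟨s i, Submodule.subset_span ⟨i, rfl⟩⟩, linearIndependent_span hs⟩⟩, rfl⟩

lemma qBinom_pos {r n k : ℕ} (hr : 1 < r) (hk : k ≤ n) : 0 < qBinom r n k := by
  have hr' : (1 : ℝ) < r := by exact_mod_cast hr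
  refine Finset.prod_pos fun j hj => ?_
  have hj := Finset.mem_range.1 hj
  exact div_pos (sub_pos.2 (one_lt_pow₀ hr' (by omega))) (sub_pos.2 (one_lt_pow₀ hr' (by omega)))

theorem card_submodule_eq_qBinom {k : ℕ} (hk : k ≤ Module.finrank F V) :
    (({W : Submodule F V | Module.finrank F W = k}.ncard : ℕ) : ℝ)
      = qBinom q (Module.finrank F V) k := by
  set n := Module.finrank F V with hn
  have hq := one_lt_cast_card F
  have key := Nat.card_congr (sigmaEquivLinearIndependent F V k)
  have : Fintype {W : Submodule F V // Module.finrank F W = k} := Fintype.ofFinite _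
  rw [Nat.card_sigma, card_linearIndependent hk] at key
  have h2 : ∀ W : {W : Submodule F V // Module.finrank F W = k},
      Nat.card {s : Fin k → W.1 // LinearIndependent F s} = ∏ i : Fin k, (q ^ k - q ^ i.val) := by
    rintro ⟨W, hW⟩
    rw [card_linearIndependent hW.ge, hW]
  simp only [h2, Finset.sum_const, smul_eq_mul, Finset.card_univ] at key
  have key' := congrArg (Nat.cast : ℕ → ℝ) key
  have cast : ∀ a : ℕ, k ≤ a → ((∏ i : Fin k, (q ^ a - q ^ i.val) : ℕ) : ℝ)
      = ∏ i ∈ Finset.range k, ((q : ℝ) ^ i * ((q : ℝ) ^ (a - i) - 1)) := by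
    intro a ha
    rw [Nat.cast_prod, ← Fin.prod_univ_eq_prod_range
      (fun i => (q : ℝ) ^ i * ((q : ℝ) ^ (a - i) - 1))]
    refine Finset.prod_congr rfl fun i _ => ?_
    rw [Nat.cast_sub (Nat.pow_le_pow_right Fintype.card_pos (by omega)), mul_sub, ← pow_add,
      Nat.add_sub_cancel' (by omega)]
    push_cast
    ring
  rw [Nat.cast_mul, cast n hk, cast k le_rfl, ← Nat.card_eq_fintype_card] at key'
  have hpos : ∏ i ∈ Finset.range k, ((q : ℝ) ^ i * ((q : ℝ) ^ (k - i) - 1)) ≠ 0 := by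
    refine Finset.prod_ne_zero_iff.2 fun i hi => ?_
    have hi := Finset.mem_range.1 hi
    exact (mul_pos (pow_pos (by linarith) _)
      (sub_pos.2 (one_lt_pow₀ hq (by omega)))).ne'
  have h3 : ({W : Submodule F V | Module.finrank F W = k}.ncard : ℝ)
      = (∏ i ∈ Finset.range k, ((q : ℝ) ^ i * ((q : ℝ) ^ (n - i) - 1))) /
        ∏ i ∈ Finset.range k, ((q : ℝ) ^ i * ((q : ℝ) ^ (k - i) - 1)) := by
    rw [eq_div_iff hpos, ← key', ← Nat.card_coe_set_eq]
    rfl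
  rw [h3, qBinom, ← Finset.prod_div_distrib]
  refine Finset.prod_congr rfl fun i _ => ?_
  rw [mul_div_mul_left _ _ (pow_pos (by linarith) _).ne']

lemma qBinom_sub_sub_mul_le {r n k e : ℕ} (hr : 1 < r) (hek : e ≤ k) (hk : k ≤ n) :
    qBinom r (n - e) (k - e) * (r : ℝ) ^ ((n - k) * e) ≤ qBinom r n k := by
  have hr' : (1 : ℝ) < r := by exact_mod_cast hr
  obtain ⟨l, rfl⟩ := Nat.exists_eq_add_of_le hek
  have h1 : qBinom r n (e + l) = (∏ j ∈ Finset.range e,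
      ((r : ℝ) ^ (n - j) - 1) / ((r : ℝ) ^ (e + l - j) - 1)) * qBinom r (n - e) l := by
    rw [qBinom, Finset.prod_range_add, qBinom]
    congr 1
    refine Finset.prod_congr rfl fun j _ => ?_
    rw [show n - (e + j) = n - e - j by omega, show e + l - (e + j) = l - j by omega]
  rw [h1, Nat.add_sub_cancel_left, mul_comm]
  refine mul_le_mul_of_nonneg_right ?_ (qBinom_pos hr (by omega)).le
  have h2 : (r : ℝ) ^ ((n - (e + l)) * e) = ∏ _j ∈ Finset.range e, (r : ℝ) ^ (n - (e + l)) := by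
    rw [Finset.prod_const, Finset.card_range, pow_mul]
  rw [h2]
  refine Finset.prod_le_prod (fun _ _ => by positivity) fun j hj => ?_
  have hj := Finset.mem_range.1 hj
  have hpos : (0 : ℝ) < (r : ℝ) ^ (e + l - j) - 1 := sub_pos.2 (one_lt_pow₀ hr' (by omega))
  rw [le_div_iff₀ hpos, mul_sub, ← pow_add, show n - (e + l) + (e + l - j) = n - j by omega]
  have : (1 : ℝ) ≤ (r : ℝ) ^ (n - (e + l)) := one_le_pow₀ hr'.le
  linarith

lemma qBinom_sub_mul_le {r n k e : ℕ} (hr : 1 < r) (hek : k + e ≤ n) :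
    qBinom r (n - e) k * (r : ℝ) ^ (k * e) ≤ qBinom r n k := by
  have hr' : (1 : ℝ) < r := by exact_mod_cast hr
  have h2 : (r : ℝ) ^ (k * e) = ∏ _j ∈ Finset.range k, (r : ℝ) ^ e := by
    rw [Finset.prod_const, Finset.card_range, mul_comm, pow_mul]
  rw [h2, qBinom, qBinom, ← Finset.prod_mul_distrib]
  have h (j : ℕ) (hj : j ∈ Finset.range k) : (0 : ℝ) < (r : ℝ) ^ (k - j) - 1 :=
    sub_pos.2 (one_lt_pow₀ hr' (by have := Finset.mem_range.1 hj; omega))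
  have h' (j : ℕ) (hj : j ∈ Finset.range k) : (0 : ℝ) < (r : ℝ) ^ (n - e - j) - 1 :=
    sub_pos.2 (one_lt_pow₀ hr' (by have := Finset.mem_range.1 hj; omega))
  refine Finset.prod_le_prod
    (fun j hj => mul_nonneg (div_pos (h' j hj) (h j hj)).le (by positivity)) fun j hj => ?_
  rw [div_mul_eq_mul_div]
  refine div_le_div_of_nonneg_right ?_ (h j hj).le
  have hj := Finset.mem_range.1 hj
  rw [sub_mul, ← pow_add, show n - e - j + e = n - j by omega]
  have : (1 : ℝ) ≤ (r : ℝ) ^ e := one_le_pow₀ hr'.le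
  linarith

lemma card_submodule_ge_le {k : ℕ} (hk : k ≤ Module.finrank F V) (U : Submodule F V)
    (hUk : Module.finrank F U ≤ k) :
    ({W : Submodule F V | Module.finrank F W = k ∧ U ≤ W}.ncard : ℝ)
      ≤ qBinom q (Module.finrank F V - Module.finrank F U) (k - Module.finrank F U) := by
  have hU := Submodule.finrank_quotient_add_finrank U
  have : Finite (V ⧸ U) := Finite.of_surjective U.mkQ U.mkQ_surjective
  have h1 : Module.finrank F V - Module.finrank F U = Module.finrank F (V ⧸ U) := by omega
  rw [h1, ← card_submodule_eq_qBinom (by omega), Nat.cast_le]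
  refine Set.ncard_le_ncard_of_injOn (fun W => W.map U.mkQ) ?_ ?_ (Set.toFinite _)
  · rintro W ⟨hW, hUW⟩
    have h2 := LinearMap.finrank_range_add_finrank_ker (U.mkQ.domRestrict W)
    rw [LinearMap.range_domRestrict, LinearMap.ker_domRestrict, Submodule.ker_mkQ] at h2
    have h3 := (Submodule.comapSubtypeEquivOfLe hUW).finrank_eq
    show Module.finrank F (W.map U.mkQ) = _
    omega
  · rintro W ⟨_, hUW⟩ W' ⟨_, hUW'⟩ h
    have := congrArg (Submodule.comap U.mkQ) h
    simpa [Submodule.comap_map_eq, hUW, hUW'] using this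

lemma card_submodule_le_le {k : ℕ} (U : Submodule F V) (hUk : k ≤ Module.finrank F U) :
    ({W : Submodule F V | Module.finrank F W = k ∧ W ≤ U}.ncard : ℝ)
      ≤ qBinom q (Module.finrank F U) k := by
  rw [← card_submodule_eq_qBinom (by omega), Nat.cast_le]
  refine Set.ncard_le_ncard_of_injOn (fun W => W.comap U.subtype) ?_ ?_ (Set.toFinite _)
  · rintro W ⟨hW, hUW⟩
    have h3 := (Submodule.comapSubtypeEquivOfLe hUW).finrank_eq
    show Module.finrank F (W.comap U.subtype) = _
    omega
  · rintro W ⟨_, hUW⟩ W' ⟨_, hUW'⟩ h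
    have := congrArg (Submodule.map U.subtype) h
    simpa [Submodule.map_comap_eq, hUW, hUW'] using this

/-- Few `k`-dimensional subspaces contain a given subspace. -/
theorem card_submodule_ge_mul_le {k : ℕ} (hk : k ≤ Module.finrank F V) (U : Submodule F V) :
    ({W : Submodule F V | Module.finrank F W = k ∧ U ≤ W}.ncard : ℝ)
        * (q : ℝ) ^ ((Module.finrank F V - k) * Module.finrank F U)
      ≤ qBinom q (Module.finrank F V) k := by
  by_cases hUk : Module.finrank F U ≤ k
  · exact (mul_le_mul_of_nonneg_right (card_submodule_ge_le hk U hUk) (by positivity)).trans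
      (qBinom_sub_sub_mul_le Fintype.one_lt_card hUk hk)
  · have : {W : Submodule F V | Module.finrank F W = k ∧ U ≤ W} = ∅ := by
      ext W
      simp only [Set.mem_ofPred_eq, Set.mem_empty_iff_false, iff_false, not_and]
      intro hW hUW
      exact hUk (hW ▸ Submodule.finrank_mono hUW)
    rw [this]
    simpa using (qBinom_pos Fintype.one_lt_card hk).le

/-- Few `k`-dimensional subspaces are contained in a given subspace of codimension `e`. -/
theorem card_submodule_le_mul_le {k e : ℕ} (hk : k ≤ Module.finrank F V) (U : Submodule F V)
    (he : Module.finrank F U + e = Module.finrank F V) :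
    ({W : Submodule F V | Module.finrank F W = k ∧ W ≤ U}.ncard : ℝ)
        * (q : ℝ) ^ (k * e)
      ≤ qBinom q (Module.finrank F V) k := by
  by_cases hUk : k ≤ Module.finrank F U
  · refine le_trans (mul_le_mul_of_nonneg_right (card_submodule_le_le U hUk) (by positivity)) ?_
    rw [show Module.finrank F U = Module.finrank F V - e by omega]
    exact qBinom_sub_mul_le Fintype.one_lt_card (e := e) (by omega)
  · have : {W : Submodule F V | Module.finrank F W = k ∧ W ≤ U} = ∅ := by
      ext W
      simp only [Set.mem_ofPred_eq, Set.mem_empty_iff_false, iff_false, not_and]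
      intro hW hUW
      exact hUk (hW ▸ Submodule.finrank_mono hUW)
    rw [this]
    simpa using (qBinom_pos Fintype.one_lt_card hk).le

end SubspaceCount

section InvariantSubspaces

variable {F V : Type} [Field F] [Fintype F] [AddCommGroup V] [Module F V] [Finite V]

local notation "q" => Fintype.card F

/-- The `k`-dimensional subspaces that are mapped into themselves by `T`. -/
def invSubspaces (F : Type) {V : Type} [Field F] [AddCommGroup V] [Module F V] (T : V → V) (k : ℕ) :
    Set (Submodule F V) :=
  {W | Module.finrank F W = k ∧ ∀ v ∈ W, T v ∈ W}

lemma card_coe_submodule (W : Submodule F V) : (W : Set V).ncard = q ^ Module.finrank F W := by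
  rw [← Nat.card_coe_set_eq, ← Nat.card_eq_fintype_card]
  exact Module.natCard_eq_pow_finrank (K := F) (V := W)

lemma card_preimage_le {A B : Type} [AddCommGroup A] [AddCommGroup B] [Finite A] [Finite B]
    (f : A →+ B) (s : Set B) :
    (f ⁻¹' s).ncard ≤ (f ⁻¹' {0}).ncard * s.ncard := by
  classical
  have := Fintype.ofFinite A
  have := Fintype.ofFinite B
  rw [Set.ncard_eq_toFinset_card' (f ⁻¹' s)]
  refine (Finset.card_le_mul_card_image (f := f) _ (f ⁻¹' {0}).ncard ?_).trans ?_
  · intro b hb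
    obtain ⟨a, _, rfl⟩ := Finset.mem_image.1 hb
    rw [← Set.ncard_coe_finset]
    refine Set.ncard_le_ncard_of_injOn (fun x => x - a) ?_ ?_ (Set.toFinite _)
    · intro x hx
      have hx' : f x = f a := (Finset.mem_filter.1 hx).2
      simp [hx']
    · intro x _ y _ h
      simpa using h
  · refine Nat.mul_le_mul_left _ ?_
    rw [← Set.ncard_coe_finset]
    refine Set.ncard_le_ncard ?_ (Set.toFinite _)
    intro b hb
    simp only [Finset.coe_image, Set.coe_toFinset] at hb
    obtain ⟨a, ha, rfl⟩ := hb
    exact ha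

lemma card_exists_smul_sub_mem_le (T : V →+ V) {κ : ℕ}
    (hκ : ∀ c : F, {v : V | T v = c • v}.ncard ≤ κ) (U : Submodule F V) :
    {v : V | ∃ c : F, T v - c • v ∈ U}.ncard ≤ q * (κ * q ^ Module.finrank F U) := by
  classical
  have h1 : {v : V | ∃ c : F, T v - c • v ∈ U} = ⋃ c : F, {v : V | T v - c • v ∈ U} := by
    ext v; simp
  rw [h1]
  refine (Set.ncard_iUnion_le_of_fintype _).trans ?_
  refine (Finset.sum_le_card_nsmul _ _ (κ * q ^ Module.finrank F U) fun c _ => ?_).trans ?_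
  · have h2 := card_preimage_le (T - (DistribSMul.toAddMonoidHom V c)) (U : Set V)
    rw [card_coe_submodule] at h2
    refine h2.trans (Nat.mul_le_mul_right _ ((hκ c).trans' (le_of_eq ?_)))
    congr 1
    ext v
    simp [sub_eq_zero]
  · simp

/-- Adjoining a vector `v` and its image `T v`. -/
def adjoin (T : V → V) (U : Submodule F V) (v : V) : Submodule F V :=
  U ⊔ Submodule.span F {v} ⊔ Submodule.span F {T v}

omit [Fintype F] in
lemma finrank_adjoin_le (T : V → V) (U : Submodule F V) (v : V) :
    Module.finrank F (adjoin T U v) ≤ Module.finrank F U + 2 := by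
  have h1 := Submodule.finrank_add_le_finrank_add_finrank U (Submodule.span F {v})
  have h2 := Submodule.finrank_add_le_finrank_add_finrank (U ⊔ Submodule.span F {v})
    (Submodule.span F {T v})
  have h3 := finrank_span_le_card (R := F) ({v} : Set V)
  have h4 := finrank_span_le_card (R := F) ({T v} : Set V)
  simp only [Set.toFinset_singleton, Finset.card_singleton] at h3 h4
  rw [adjoin]
  omega

omit [Fintype F] in
lemma finrank_add_one_le_sup_span (U : Submodule F V) {v : V} (hv : v ∉ U) :
    Module.finrank F U + 1 ≤ Module.finrank F (U ⊔ Submodule.span F {v} : Submodule F V) := by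
  apply Submodule.finrank_lt_finrank_of_lt
  refine lt_of_le_of_ne le_sup_left fun h => hv ?_
  rw [h]
  exact Submodule.mem_sup_right (Submodule.mem_span_singleton_self v)

omit [Fintype F] in
lemma finrank_add_two_le_adjoin (T : V → V) (U : Submodule F V) {v : V} (hv : v ∉ U)
    (hT : ¬ ∃ c : F, T v - c • v ∈ U) :
    Module.finrank F U + 2 ≤ Module.finrank F (adjoin T U v) := by
  have h1 := finrank_add_one_le_sup_span U hv
  have h2 : T v ∉ U ⊔ Submodule.span F {v} := by
    intro h
    obtain ⟨u, hu, w, hw, huw⟩ := Submodule.mem_sup.1 h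
    obtain ⟨c, rfl⟩ := Submodule.mem_span_singleton.1 hw
    exact hT ⟨c, by rwa [← huw, add_sub_cancel_right]⟩
  have h3 := finrank_add_one_le_sup_span _ h2
  rw [adjoin]
  omega

omit [Fintype F] [Finite V] in
lemma adjoin_le_iff {T : V → V} {U W : Submodule F V} {v : V} :
    adjoin T U v ≤ W ↔ U ≤ W ∧ v ∈ W ∧ T v ∈ W := by
  simp [adjoin, and_assoc]

lemma sum_card_adjoin [Fintype V] (T : V → V) (k : ℕ) (U : Submodule F V) :
    ∑ v : V, (invSubspaces F T k ∩ {W | adjoin T U v ≤ W}).ncard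
      = (invSubspaces F T k ∩ {W | U ≤ W}).ncard * q ^ k := by
  classical
  have := Fintype.ofFinite (Submodule F V)
  set t : Finset (Submodule F V) := (invSubspaces F T k ∩ {W | U ≤ W}).toFinset with ht
  have h := Finset.sum_card_bipartiteAbove_eq_sum_card_bipartiteBelow (s := Finset.univ) (t := t)
    (fun (v : V) (W : Submodule F V) => v ∈ W)
  have h1 : ∀ W ∈ t, (Finset.univ.bipartiteBelow (fun (v : V) (W : Submodule F V) => v ∈ W) W).card
      = q ^ k := by
    intro W hW
    have hW' : Module.finrank F W = k := by
      have : W ∈ invSubspaces F T k ∩ {W | U ≤ W} := by simpa [ht] using hW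
      exact this.1.1
    rw [← hW', ← card_coe_submodule, ← Set.ncard_coe_finset]
    congr 1
    ext v
    simp [Finset.bipartiteBelow]
  rw [Finset.sum_congr rfl h1, Finset.sum_const, smul_eq_mul, ht,
    ← Set.ncard_eq_toFinset_card'] at h
  rw [← h]
  refine Finset.sum_congr rfl fun v _ => ?_
  rw [← Set.ncard_coe_finset]
  congr 1
  ext W
  simp only [invSubspaces, adjoin_le_iff, Finset.bipartiteAbove]
  simp
  grind

/-- An additive map with few eigenvectors has few invariant subspaces: relative form. -/
lemma card_invSubspaces_ge_le {k : ℕ} (hk : k ≤ Module.finrank F V) (T : V →+ V) {κ J : ℕ}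
    (hκ : ∀ c : F, {v : V | T v = c • v}.ncard ≤ κ) (j : ℕ) :
    ∀ U : Submodule F V, Module.finrank F U + 2 * j ≤ 2 * J →
      ((invSubspaces F T k ∩ {W | U ≤ W}).ncard : ℝ) ≤
        qBinom q (Module.finrank F V) k *
          (((q : ℝ) ^ Module.finrank F V * (((q : ℝ) ^ (Module.finrank F V - k))⁻¹) ^ 2
            + q * (κ * (q : ℝ) ^ (2 * J)) * ((q : ℝ) ^ (Module.finrank F V - k))⁻¹
            + (q : ℝ) ^ (2 * J)) / (q : ℝ) ^ k) ^ j
          * (((q : ℝ) ^ (Module.finrank F V - k))⁻¹) ^ Module.finrank F U := by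
  classical
  have := Fintype.ofFinite V
  have hq := one_lt_cast_card F
  set n := Module.finrank F V
  set γ : ℝ := ((q : ℝ) ^ (n - k))⁻¹ with hγ
  have hγ0 : 0 < γ := by positivity
  have hγ1 : γ ≤ 1 := inv_le_one_of_one_le₀ (one_le_pow₀ hq.le)
  set β : ℝ := ((q : ℝ) ^ n * γ ^ 2 + q * (κ * (q : ℝ) ^ (2 * J)) * γ + (q : ℝ) ^ (2 * J))
    / (q : ℝ) ^ k with hβ
  have hβ0 : 0 ≤ β := by positivity
  have hg : 0 < qBinom q n k := qBinom_pos Fintype.one_lt_card hk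
  induction j with
  | zero =>
    intro U _
    have h1 := card_submodule_ge_mul_le hk U
    rw [pow_mul] at h1
    rw [pow_zero, mul_one, hγ, inv_pow, ← div_eq_mul_inv, le_div_iff₀ (by positivity)]
    refine h1.trans' (mul_le_mul_of_nonneg_right ?_ (by positivity))
    rw [Nat.cast_le]
    exact Set.ncard_le_ncard (fun W hW => ⟨hW.1.1, hW.2⟩) (Set.toFinite _)
  | succ j ih =>
    intro U hU
    set u := Module.finrank F U
    have hsum : ((invSubspaces F T k ∩ {W | U ≤ W}).ncard : ℝ) * (q : ℝ) ^ k
        = ∑ v : V, ((invSubspaces F T k ∩ {W | adjoin T U v ≤ W}).ncard : ℝ) := by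
      exact_mod_cast (sum_card_adjoin T k U).symm
    obtain ⟨S, hS⟩ : ∃ S : Set V, S = {v : V | ∃ c : F, T v - c • v ∈ U} := ⟨_, rfl⟩
    have hpt (v : V) : ((invSubspaces F T k ∩ {W | adjoin T U v ≤ W}).ncard : ℝ)
        ≤ qBinom q n k * β ^ j * γ ^ u *
          (γ ^ 2 + (if v ∈ S then γ else 0)
            + (if v ∈ (U : Set V) then 1 else 0)) := by
      have h2 := finrank_adjoin_le T U v
      refine (ih (adjoin T U v) (by omega)).trans ?_
      rw [mul_assoc _ (γ ^ u)]
      refine mul_le_mul_of_nonneg_left ?_ (by positivity)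
      by_cases hv : v ∈ U
      · rw [if_pos (show v ∈ (U : Set V) from hv)]
        calc γ ^ Module.finrank F (adjoin T U v) ≤ γ ^ u :=
              pow_le_pow_of_le_one hγ0.le hγ1 (Submodule.finrank_mono (adjoin_le_iff.1 le_rfl).1)
          _ = γ ^ u * (0 + 0 + 1) := by ring
          _ ≤ _ := by
            refine mul_le_mul_of_nonneg_left ?_ (by positivity)
            gcongr
            · positivity
            · split_ifs <;> positivity
      · by_cases hT : ∃ c : F, T v - c • v ∈ U
        · rw [if_pos (show v ∈ S from hS ▸ hT)]
          have h3 : u + 1 ≤ Module.finrank F (adjoin T U v) :=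
            (finrank_add_one_le_sup_span U hv).trans (Submodule.finrank_mono le_sup_left)
          calc γ ^ Module.finrank F (adjoin T U v) ≤ γ ^ (u + 1) :=
                pow_le_pow_of_le_one hγ0.le hγ1 h3
            _ = γ ^ u * (0 + γ + 0) := by ring
            _ ≤ _ := by
              refine mul_le_mul_of_nonneg_left ?_ (by positivity)
              gcongr
              · positivity
              · split_ifs <;> positivity
        · have h3 := finrank_add_two_le_adjoin T U hv hT
          calc γ ^ Module.finrank F (adjoin T U v) ≤ γ ^ (u + 2) :=
                pow_le_pow_of_le_one hγ0.le hγ1 h3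
            _ = γ ^ u * (γ ^ 2 + 0 + 0) := by ring
            _ ≤ _ := by
              refine mul_le_mul_of_nonneg_left ?_ (by positivity)
              gcongr <;> split_ifs <;> positivity
    have hcard : (Fintype.card V : ℝ) = (q : ℝ) ^ n := by
      rw [Module.card_eq_pow_finrank (K := F) (V := V)]
      push_cast
      rfl
    have hite (s : Set V) (c : ℝ) : ∑ v : V, (if v ∈ s then c else 0) = s.ncard * c := by
      rw [← Finset.sum_filter, Finset.sum_const, nsmul_eq_mul, ← Set.ncard_coe_finset]
      congr 3
      ext v
      simp
    have hU1 : (q : ℝ) ^ u ≤ (q : ℝ) ^ (2 * J) := pow_le_pow_right₀ hq.le (by omega)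
    have htot : ∑ v : V, (γ ^ 2 + (if v ∈ S then γ else 0)
            + (if v ∈ (U : Set V) then 1 else 0)) ≤ β * (q : ℝ) ^ k := by
      rw [Finset.sum_add_distrib, Finset.sum_add_distrib, hite, hite, Finset.sum_const, mul_one,
        Finset.card_univ, nsmul_eq_mul, hcard, card_coe_submodule, hβ,
        div_mul_cancel₀ _ (by positivity)]
      have h4 := card_exists_smul_sub_mem_le T hκ U
      have h4' : (S.ncard : ℝ)
          ≤ q * (κ * (q : ℝ) ^ u) := by rw [hS]; exact_mod_cast h4
      push_cast
      have h5 : (q : ℝ) * (κ * (q : ℝ) ^ u) ≤ q * (κ * (q : ℝ) ^ (2 * J)) := by gcongr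
      gcongr
      exact h4'.trans h5
    have hfin : ((invSubspaces F T k ∩ {W | U ≤ W}).ncard : ℝ) * (q : ℝ) ^ k
        ≤ (qBinom q n k * β ^ (j + 1) * γ ^ u) * (q : ℝ) ^ k := by
      rw [hsum]
      refine (Finset.sum_le_sum fun v _ => hpt v).trans ?_
      rw [← Finset.mul_sum]
      refine (mul_le_mul_of_nonneg_left htot (by positivity)).trans (le_of_eq ?_)
      ring
    exact le_of_mul_le_mul_right hfin (by positivity)

/-- An additive map with few eigenvectors has few invariant subspaces of middle dimension. -/
theorem card_invSubspaces_le_of_card_eigenvectors {k J c : ℕ} (T : V →+ V)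
    (hκ : ∀ a : F, {v : V | T v = a • v}.ncard ≤ q ^ c) (hc : 4 * c ≤ 3 * Module.finrank F V)
    (hk1 : Module.finrank F V ≤ 4 * k) (hk2 : 4 * k ≤ 3 * Module.finrank F V) :
    ((invSubspaces F T k).ncard : ℝ) ≤ qBinom q (Module.finrank F V) k *
      ((q : ℝ) ^ (3 + 2 * (J : ℝ) - (Module.finrank F V : ℝ) / 4)) ^ J := by
  have hq := one_lt_cast_card F
  have hq0 : (0 : ℝ) < q := by linarith
  have hk : k ≤ Module.finrank F V := by omega
  have h := card_invSubspaces_ge_le (J := J) hk T hκ J ⊥ (by simp)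
  have h1 : invSubspaces F T k ∩ {W | ⊥ ≤ W} = invSubspaces F T k := by simp
  rw [h1, finrank_bot, pow_zero, mul_one] at h
  refine h.trans (mul_le_mul_of_nonneg_left (pow_le_pow_left₀ (by positivity) ?_ _)
    (qBinom_pos Fintype.one_lt_card hk).le)
  set n := Module.finrank F V
  rw [div_le_iff₀ (by positivity)]
  push_cast
  simp only [← Real.rpow_natCast, ← Real.rpow_neg hq0.le, ← Real.rpow_mul hq0.le,
    ← Real.rpow_add hq0]
  rw [Nat.cast_sub hk]
  push_cast
  have e1 : (n : ℝ) ≤ 4 * k := by exact_mod_cast hk1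
  have e2 : 4 * (k : ℝ) ≤ 3 * n := by exact_mod_cast hk2
  have e3 : 4 * (c : ℝ) ≤ 3 * n := by exact_mod_cast hc
  set X : ℝ := (q : ℝ) ^ (2 * (J : ℝ) - (n : ℝ) / 4 + k) with hX
  have hX0 : 0 < X := by positivity
  have t1 : (q : ℝ) ^ ((n : ℝ) + -((n : ℝ) - k) * 2) ≤ X :=
    Real.rpow_le_rpow_of_exponent_le hq.le (by have : (0 : ℝ) ≤ J := by positivity
                                               linarith)
  have t2 : (q : ℝ) * (q : ℝ) ^ ((c : ℝ) + 2 * J) * (q : ℝ) ^ (-((n : ℝ) - k)) ≤ q * X := by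
    rw [mul_assoc, ← Real.rpow_add hq0]
    exact mul_le_mul_of_nonneg_left
      (Real.rpow_le_rpow_of_exponent_le hq.le (by linarith)) hq0.le
  have t3 : (q : ℝ) ^ (2 * (J : ℝ)) ≤ X :=
    Real.rpow_le_rpow_of_exponent_le hq.le (by linarith)
  have t4 : (q : ℝ) ^ (3 + 2 * (J : ℝ) - (n : ℝ) / 4 + k) = (q : ℝ) ^ 3 * X := by
    rw [hX, ← Real.rpow_natCast, ← Real.rpow_add hq0]
    congr 1
    push_cast
    ring
  have hq2 : (2 : ℝ) ≤ q := by exact_mod_cast Fintype.one_lt_card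
  have t5 : (q : ℝ) + 2 ≤ (q : ℝ) ^ 3 := by nlinarith [sq_nonneg ((q : ℝ) - 2)]
  rw [t4]
  nlinarith

end InvariantSubspaces

section SmallRank

variable {F V : Type} [Field F] [Fintype F] [AddCommGroup V] [Module F V] [Finite V]

local notation "q" => Fintype.card F

lemma qBinom_le_pow {r n k : ℕ} (hr : 1 < r) (hk : k ≤ n) :
    qBinom r n k ≤ (r : ℝ) ^ ((n - k + 1) * k) := by
  have hr' : (1 : ℝ) < r := by exact_mod_cast hr
  have hr2 : (2 : ℝ) ≤ r := by exact_mod_cast hr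
  have h2 : (r : ℝ) ^ ((n - k + 1) * k) = ∏ _j ∈ Finset.range k, (r : ℝ) ^ (n - k + 1) := by
    rw [Finset.prod_const, Finset.card_range, pow_mul]
  rw [qBinom, h2]
  have h (j : ℕ) (hj : j ∈ Finset.range k) : (0 : ℝ) < (r : ℝ) ^ (k - j) - 1 :=
    sub_pos.2 (one_lt_pow₀ hr' (by have := Finset.mem_range.1 hj; omega))
  have h' (j : ℕ) (hj : j ∈ Finset.range k) : (0 : ℝ) < (r : ℝ) ^ (n - j) - 1 :=
    sub_pos.2 (one_lt_pow₀ hr' (by have := Finset.mem_range.1 hj; omega))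
  refine Finset.prod_le_prod (fun j hj => (div_pos (h' j hj) (h j hj)).le) fun j hj => ?_
  rw [div_le_iff₀ (h j hj), mul_sub, ← pow_add]
  have hj := Finset.mem_range.1 hj
  rw [show n - k + 1 + (k - j) = n - j + 1 by omega, pow_succ]
  have h3 : (r : ℝ) ^ (n - k + 1) ≤ (r : ℝ) ^ (n - j) := pow_le_pow_right₀ hr'.le (by omega)
  nlinarith [pow_pos (show (0 : ℝ) < r by linarith) (n - j)]

omit [Fintype F] in
lemma exists_submodule_between {A B : Submodule F V} (hAB : A ≤ B) {d : ℕ}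
    (hA : Module.finrank F A ≤ d) (hB : d ≤ Module.finrank F B) :
    ∃ C : Submodule F V, A ≤ C ∧ C ≤ B ∧ Module.finrank F C = d := by
  induction d, hA using Nat.le_induction with
  | base => exact ⟨A, le_rfl, hAB, rfl⟩
  | succ d _ ih =>
    obtain ⟨C, hAC, hCB, hC⟩ := ih (by omega)
    have hne : ¬ B ≤ C := fun h => by
      have := Submodule.finrank_mono h
      omega
    obtain ⟨v, hvB, hvC⟩ := SetLike.not_le_iff_exists.1 hne
    refine ⟨C ⊔ Submodule.span F {v}, hAC.trans le_sup_left,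
      sup_le hCB ((Submodule.span_singleton_le_iff_mem _ _).2 hvB), ?_⟩
    have h1 := finrank_add_one_le_sup_span C hvC
    have h2 := Submodule.finrank_add_le_finrank_add_finrank C (Submodule.span F {v})
    have h3 := finrank_span_le_card (R := F) ({v} : Set V)
    simp only [Set.toFinset_singleton, Finset.card_singleton] at h3
    omega

omit [Fintype F] in
/-- A subspace invariant under a map of rank `r` contains a large part of the range or is
contained in a small space above the kernel. -/
lemma exists_le_range_or_ker_le (R : V →ₗ[F] V) {W : Submodule F V} (hW : ∀ v ∈ W, R v ∈ W)
    {e : ℕ} (he : 2 * e ≤ Module.finrank F (LinearMap.range R) + 1)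
    (he' : e ≤ Module.finrank F (LinearMap.range R)) :
    (∃ B ≤ LinearMap.range R, Module.finrank F B = e ∧ B ≤ W) ∨
      ∃ H, LinearMap.ker R ≤ H ∧ Module.finrank F H = Module.finrank F V - e ∧ W ≤ H := by
  have hR := LinearMap.finrank_range_add_finrank_ker R
  by_cases h : e ≤ Module.finrank F (W ⊓ LinearMap.range R : Submodule F V)
  · left
    obtain ⟨B, _, hB, hBe⟩ := exists_submodule_between (bot_le (a := W ⊓ LinearMap.range R))
      (d := e) (by simp) h
    exact ⟨B, hB.trans inf_le_right, hBe, hB.trans inf_le_left⟩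
  · right
    have h1 : W.map R ≤ W ⊓ LinearMap.range R := by
      rintro _ ⟨w, hw, rfl⟩
      exact ⟨hW w hw, ⟨w, rfl⟩⟩
    have h2 := Submodule.finrank_mono h1
    have h3 := LinearMap.finrank_range_add_finrank_ker (R.domRestrict W)
    rw [LinearMap.range_domRestrict, LinearMap.ker_domRestrict] at h3
    have h4 : Module.finrank F (LinearMap.ker R ⊓ W : Submodule F V)
        = Module.finrank F ((LinearMap.ker R).comap W.subtype) := by
      rw [inf_comm, ← Submodule.map_comap_subtype]
      exact (Submodule.equivMapOfInjective _ W.subtype_injective _).finrank_eq.symm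
    have h5 := Submodule.finrank_sup_add_finrank_inf_eq (LinearMap.ker R) W
    obtain ⟨H, hH1, _, hH3⟩ := exists_submodule_between (le_top (a := LinearMap.ker R ⊔ W))
      (d := Module.finrank F V - e) (by omega) (by rw [finrank_top]; omega)
    exact ⟨H, le_sup_left.trans hH1, hH3, le_sup_right.trans hH1⟩

lemma ncard_exists_le {α β : Type} [Finite α] [Finite β] (s : Set β) (p : β → Set α) {M N : ℝ}
    (hM : (s.ncard : ℝ) ≤ M) (hN : ∀ b ∈ s, ((p b).ncard : ℝ) ≤ N) (hN0 : 0 ≤ N) :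
    ({a | ∃ b ∈ s, a ∈ p b}.ncard : ℝ) ≤ M * N := by
  classical
  have := Fintype.ofFinite β
  have h1 : {a | ∃ b ∈ s, a ∈ p b} = ⋃ b ∈ s.toFinset, p b := by
    ext a; simp
  rw [h1]
  calc ((⋃ b ∈ s.toFinset, p b).ncard : ℝ) ≤ ∑ b ∈ s.toFinset, ((p b).ncard : ℝ) := by
        exact_mod_cast Finset.set_ncard_biUnion_le _ _
    _ ≤ ∑ b ∈ s.toFinset, N := Finset.sum_le_sum fun b hb => hN b (by simpa using hb)
    _ = s.ncard * N := by rw [Finset.sum_const, nsmul_eq_mul, ← Set.ncard_eq_toFinset_card']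
    _ ≤ M * N := by gcongr

/-- A nonzero linear map of small rank has few invariant subspaces of middle dimension. -/
theorem card_invSubspaces_le_of_rank {k : ℕ} (R : V →ₗ[F] V)
    (hr : 4 * Module.finrank F (LinearMap.range R) ≤ Module.finrank F V)
    (hr0 : 1 ≤ Module.finrank F (LinearMap.range R))
    (hk1 : 3 * Module.finrank F V ≤ 8 * k) (hk2 : 8 * k ≤ 5 * Module.finrank F V) :
    ((invSubspaces F R k).ncard : ℝ) ≤ qBinom q (Module.finrank F V) k *
      (2 * (q : ℝ) ^ (-((Module.finrank F (LinearMap.range R) : ℝ)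
        * (Module.finrank F V : ℝ) / 16))) := by
  have hq := one_lt_cast_card F
  have hq0 : (0 : ℝ) < q := by linarith
  have hk : k ≤ Module.finrank F V := by omega
  have hR := LinearMap.finrank_range_add_finrank_ker R
  set n := Module.finrank F V
  set r := Module.finrank F (LinearMap.range R)
  obtain ⟨e, he1, he2⟩ : ∃ e, r ≤ 2 * e ∧ 2 * e ≤ r + 1 := ⟨(r + 1) / 2, by omega, by omega⟩
  have hg := qBinom_pos (r := q) Fintype.one_lt_card hk
  set g := qBinom q n k
  have hcast : (r : ℝ) ≤ 2 * e := by exact_mod_cast he1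
  have hcast2 : 4 * (r : ℝ) ≤ n := by exact_mod_cast hr
  have hcast3 : 3 * (n : ℝ) ≤ 8 * k := by exact_mod_cast hk1
  have hcast4 : 8 * (k : ℝ) ≤ 5 * n := by exact_mod_cast hk2
  have hen : (0 : ℝ) ≤ e * n := by positivity
  have hB : ({B : Submodule F V | Module.finrank F B = e ∧ B ≤ LinearMap.range R}.ncard : ℝ)
      ≤ (q : ℝ) ^ (r * e) := by
    refine (card_submodule_le_le _ (by omega)).trans
      ((qBinom_le_pow Fintype.one_lt_card (by omega)).trans (pow_le_pow_right₀ hq.le ?_))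
    exact Nat.mul_le_mul_right _ (by omega)
  have hH : ({H : Submodule F V | Module.finrank F H = n - e ∧ LinearMap.ker R ≤ H}.ncard : ℝ)
      ≤ (q : ℝ) ^ (r * e) := by
    refine (card_submodule_ge_le (Nat.sub_le _ _) _ (by omega)).trans
      ((qBinom_le_pow Fintype.one_lt_card (by omega)).trans (pow_le_pow_right₀ hq.le ?_))
    rw [show n - Module.finrank F (LinearMap.ker R) = r by omega,
      show n - e - Module.finrank F (LinearMap.ker R) = r - e by omega,
      show r - (r - e) = e by omega]
    obtain ⟨d, rfl⟩ : ∃ d, e = d + 1 := ⟨e - 1, by omega⟩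
    have h1 : r - (d + 1) ≤ d + 1 := by omega
    obtain ⟨s, hs⟩ : ∃ s, r = s + (d + 1) := ⟨r - (d + 1), by omega⟩
    rw [hs, Nat.add_sub_cancel]
    nlinarith [show s ≤ d + 1 by omega]
  have hsub : invSubspaces F R k ⊆
      {W | ∃ B ∈ {B : Submodule F V | Module.finrank F B = e ∧ B ≤ LinearMap.range R},
        W ∈ {W : Submodule F V | Module.finrank F W = k ∧ B ≤ W}} ∪
      {W | ∃ H ∈ {H : Submodule F V | Module.finrank F H = n - e ∧ LinearMap.ker R ≤ H},
        W ∈ {W : Submodule F V | Module.finrank F W = k ∧ W ≤ H}} := by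
    rintro W ⟨hWk, hWR⟩
    rcases exists_le_range_or_ker_le R hWR (e := e) (by omega) (by omega) with
      ⟨B, hB1, hB2, hB3⟩ | ⟨H, hH1, hH2, hH3⟩
    · exact Or.inl ⟨B, ⟨hB2, hB1⟩, hWk, hB3⟩
    · exact Or.inr ⟨H, ⟨hH2, hH1⟩, hWk, hH3⟩
  have b1 := ncard_exists_le _ (fun B : Submodule F V =>
      {W : Submodule F V | Module.finrank F W = k ∧ B ≤ W}) hB (N := g * ((q : ℝ) ^ ((n - k) * e))⁻¹)
    (fun B hB => by
      have h := card_submodule_ge_mul_le hk B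
      rw [hB.1] at h
      rwa [← div_eq_mul_inv, le_div_iff₀ (by positivity)]) (by positivity)
  have b2 := ncard_exists_le _ (fun B : Submodule F V =>
      {W : Submodule F V | Module.finrank F W = k ∧ W ≤ B}) hH (N := g * ((q : ℝ) ^ (k * e))⁻¹)
    (fun B hB => by
      have h := card_submodule_le_mul_le (e := e) hk B
        (by have := hB.1; omega)
      rwa [← div_eq_mul_inv, le_div_iff₀ (by positivity)]) (by positivity)
  have hexp (a : ℕ) (ha : 3 * (n : ℝ) ≤ 8 * a) : (q : ℝ) ^ (r * e) * (g * ((q : ℝ) ^ (a * e))⁻¹)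
      ≤ g * (q : ℝ) ^ (-((r : ℝ) * n / 16)) := by
    rw [mul_left_comm]
    refine mul_le_mul_of_nonneg_left ?_ hg.le
    rw [← Real.rpow_natCast, ← Real.rpow_natCast, ← Real.rpow_neg hq0.le, ← Real.rpow_add hq0]
    refine Real.rpow_le_rpow_of_exponent_le hq.le ?_
    push_cast
    have h1 : (r : ℝ) * n ≤ 2 * e * n := by gcongr
    have h2 : (r : ℝ) * e ≤ n / 4 * e := mul_le_mul_of_nonneg_right (by linarith) (by positivity)
    have h3 : (3 * (n : ℝ) / 8) * e ≤ a * e :=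
      mul_le_mul_of_nonneg_right (by linarith) (by positivity)
    nlinarith
  calc ((invSubspaces F R k).ncard : ℝ) ≤ _ := by
        exact Nat.cast_le.2 ((Set.ncard_le_ncard hsub (Set.toFinite _)).trans (Set.ncard_union_le _ _))
    _ ≤ g * (q : ℝ) ^ (-((r : ℝ) * n / 16)) + g * (q : ℝ) ^ (-((r : ℝ) * n / 16)) := by
        push_cast
        refine add_le_add (b1.trans (hexp _ ?_)) (b2.trans (hexp _ hcast3))
        rw [Nat.cast_sub hk]
        linarith
    _ = _ := by ring

end SmallRank

section SemilinearMonomial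

variable {F : Type} [Field F] {n : ℕ}

/-- Data of a semilinear monomial transformation: a field automorphism, a permutation of the
coordinates, and nonzero scaling factors. -/
abbrev SemiMon (F : Type) [Field F] (n : ℕ) : Type :=
  (F ≃+* F) × Equiv.Perm (Fin n) × (Fin n → Fˣ)

/-- The semilinear monomial transformation given by its data. -/
def SemiMon.map (p : SemiMon F n) : (Fin n → F) →+ (Fin n → F) where
  toFun x i := p.2.2 i * p.1 (x (p.2.1 i))
  map_zero' := by ext; simp
  map_add' x y := by ext; simp [mul_add]

lemma SemiMon.map_apply (p : SemiMon F n) (x : Fin n → F) (i : Fin n) :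
    p.map x i = p.2.2 i * p.1 (x (p.2.1 i)) := rfl

/-- The data giving scalar multiplications. -/
def SemiMon.IsScalar (p : SemiMon F n) : Prop :=
  p.1 = 1 ∧ ∃ a : Fˣ, p.2 = (1, fun _ => a)

lemma SemiMon.map_injective (p : SemiMon F n) : Function.Injective p.map := by
  intro x y h
  ext i
  have h1 := congrFun h (p.2.1.symm i)
  simpa [SemiMon.map_apply] using h1

lemma SemiMon.map_smul (p : SemiMon F n) (c : F) (x : Fin n → F) :
    p.map (c • x) = p.1 c • p.map x := by
  ext i
  simp [SemiMon.map_apply, mul_left_comm]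

/-- A properly semilinear map has few eigenvectors. -/
lemma SemiMon.card_eigenvectors_sq_le [Fintype F] (p : SemiMon F n) (hp : p.1 ≠ 1) {a : F}
    (ha : a ≠ 0) : {v : Fin n → F | p.map v = a • v}.ncard ^ 2 ≤ Fintype.card F ^ n := by
  obtain ⟨b, hb⟩ : ∃ b, p.1 b ≠ b := by
    by_contra! h
    exact hp (RingEquiv.ext h)
  set K := {v : Fin n → F | p.map v = a • v}
  have h1 : (K ×ˢ K).ncard ≤ (Set.univ : Set (Fin n → F)).ncard := by
    refine Set.ncard_le_ncard_of_injOn (fun x => x.1 + b • x.2) (fun _ _ => Set.mem_univ _) ?_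
      (Set.toFinite _)
    rintro ⟨u, v⟩ ⟨hu, hv⟩ ⟨u', v'⟩ ⟨hu', hv'⟩ h
    simp only at h hu hv hu' hv'
    have hv0 : v - v' = 0 := by
      have e1 : u - u' = b • (v' - v) := by
        rw [smul_sub, sub_eq_sub_iff_add_eq_add, h, add_comm]
      have e2 : p.map (u - u') = a • (u - u') := by
        rw [map_sub, show p.map u = a • u from hu, show p.map u' = a • u' from hu', smul_sub]
      have e3 : p.map (v' - v) = a • (v' - v) := by
        rw [map_sub, show p.map v = a • v from hv, show p.map v' = a • v' from hv', smul_sub]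
      rw [e1, SemiMon.map_smul, e3, smul_smul, smul_smul, ← sub_eq_zero, ← sub_smul,
        smul_eq_zero] at e2
      rcases e2 with e2 | e2
      · refine absurd (mul_right_cancel₀ ha ?_) hb
        rw [sub_eq_zero] at e2
        rw [e2, mul_comm]
      · rw [← neg_sub, e2, neg_zero]
    obtain rfl : v = v' := sub_eq_zero.1 hv0
    obtain rfl : u = u' := by simpa using h
    rfl
  rw [Set.ncard_prod, Set.ncard_univ, Nat.card_eq_fintype_card, Fintype.card_fun,
    Fintype.card_fin] at h1
  rwa [sq]

/-- The linear part of a monomial transformation, minus a scalar. -/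
def monSub (π : Equiv.Perm (Fin n)) (d : Fin n → Fˣ) (a : Fˣ) : (Fin n → F) →ₗ[F] (Fin n → F) where
  toFun x i := d i * x (π i) - a * x i
  map_add' x y := by ext i; simp only [Pi.add_apply]; ring
  map_smul' c x := by ext i; simp only [Pi.smul_apply, smul_eq_mul, RingHom.id_apply]; ring

lemma monSub_apply (π : Equiv.Perm (Fin n)) (d : Fin n → Fˣ) (a : Fˣ) (x : Fin n → F) (i : Fin n) :
    monSub π d a x i = d i * x (π i) - a * x i := rfl

open Classical in
/-- The coordinates on which a monomial transformation differs from a scalar. -/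
noncomputable def monSupport (π : Equiv.Perm (Fin n)) (d : Fin n → Fˣ) (a : Fˣ) : Finset (Fin n) :=
  Finset.univ.filter fun i => (π i, d i) ≠ (i, a)

lemma mem_monSupport {π : Equiv.Perm (Fin n)} {d : Fin n → Fˣ} {a : Fˣ} {i : Fin n} :
    i ∈ monSupport π d a ↔ (π i, d i) ≠ (i, a) := by
  simp [monSupport]

open Classical in
lemma card_filter_le_rank_monSub (π : Equiv.Perm (Fin n)) (d : Fin n → Fˣ) (a : Fˣ)
    (f : Fin n → ℕ) :
    ((monSupport π d a).filter fun i => f (π i) < f i ∨ π i = i).card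
      ≤ Module.finrank F (LinearMap.range (monSub π d a)) := by
  set I := (monSupport π d a).filter fun i => f (π i) < f i ∨ π i = i with hI
  have h1 := LinearMap.finrank_range_add_finrank_ker (monSub π d a)
  rw [Module.finrank_fin_fun] at h1
  let ρ : LinearMap.ker (monSub π d a) →ₗ[F] ({i // i ∉ I} → F) :=
    (LinearMap.funLeft F F (Subtype.val : {i // i ∉ I} → Fin n)).comp (Submodule.subtype _)
  have hρ : Function.Injective ρ := by
    rw [← LinearMap.ker_eq_bot, LinearMap.ker_eq_bot']
    rintro ⟨x, hx⟩ h
    have hoff (i : Fin n) (hi : i ∉ I) : x i = 0 := congrFun h ⟨i, hi⟩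
    have hker (i : Fin n) : (d i : F) * x (π i) - a * x i = 0 :=
      congrFun (LinearMap.mem_ker.1 hx) i
    have hall : ∀ N : ℕ, ∀ i, f i = N → x i = 0 := by
      intro N
      induction N using Nat.strong_induction_on with
      | _ N ih =>
        rintro i rfl
        by_cases hi : i ∈ I
        · obtain ⟨hs, hi⟩ := Finset.mem_filter.1 hi
          have hs : (π i, d i) ≠ (i, a) := mem_monSupport.1 hs
          have hk := hker i
          rcases hi with hi | hi
          · rw [ih _ hi _ rfl] at hk
            simpa using hk
          · rw [hi, ← sub_mul] at hk
            rcases mul_eq_zero.1 hk with hk | hk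
            · exact absurd (by rw [hi, Units.ext (sub_eq_zero.1 hk)]) hs
            · exact hk
        · exact hoff i hi
    ext i
    exact hall _ i rfl
  have h2 := LinearMap.finrank_le_finrank_of_injective hρ
  rw [Module.finrank_fintype_fun_eq_card] at h2
  have h3 : Fintype.card {i // i ∉ I} = n - I.card := by
    rw [Fintype.card_subtype_compl, Fintype.card_fin, Fintype.card_coe]
  have h4 : I.card ≤ n := by simpa using I.card_le_univ
  omega

/-- A monomial transformation differing from a scalar in many coordinates has large rank after
subtracting the scalar. -/
lemma card_monSupport_le (π : Equiv.Perm (Fin n)) (d : Fin n → Fˣ) (a : Fˣ) :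
    (monSupport π d a).card ≤ 2 * Module.finrank F (LinearMap.range (monSub π d a)) := by
  classical
  have h1 := card_filter_le_rank_monSub π d a (fun i => (i : ℕ))
  have h2 := card_filter_le_rank_monSub π d a (fun i => n - (i : ℕ))
  have h3 : monSupport π d a ⊆
      (monSupport π d a).filter (fun i => ((π i : Fin n) : ℕ) < (i : ℕ) ∨ π i = i) ∪
      (monSupport π d a).filter (fun i => n - ((π i : Fin n) : ℕ) < n - (i : ℕ) ∨ π i = i) := by
    intro i hi
    simp only [Finset.mem_union, Finset.mem_filter, hi, true_and]
    have := i.2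
    have := (π i).2
    rw [Fin.ext_iff]
    omega
  have h4 := (Finset.card_le_card h3).trans (Finset.card_union_le _ _)
  omega

lemma SemiMon.map_eq_monSub_add {p : SemiMon F n} (hp : p.1 = 1) (a : Fˣ) (x : Fin n → F) :
    p.map x = monSub p.2.1 p.2.2 a x + (a : F) • x := by
  ext i
  simp [SemiMon.map_apply, monSub_apply, hp]

/-- Transformations without a large eigenspace have few invariant subspaces; the others are
controlled by the coordinates on which they differ from a scalar. -/
lemma SemiMon.exists_rank_le_of_card_eigenvectors [Fintype F] (hn : 2 ≤ n) (p : SemiMon F n)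
    (hp : ¬ ∀ a : F, {v : Fin n → F | p.map v = a • v}.ncard ≤ Fintype.card F ^ (3 * n / 4)) :
    p.1 = 1 ∧ ∃ a : Fˣ, 4 * Module.finrank F (LinearMap.range (monSub p.2.1 p.2.2 a)) ≤ n := by
  push Not at hp
  obtain ⟨a, ha⟩ := hp
  have hq : 1 < Fintype.card F := Fintype.one_lt_card
  have ha0 : a ≠ 0 := by
    rintro rfl
    have h1 : {v : Fin n → F | p.map v = (0 : F) • v} = {0} := by
      ext v
      simp only [zero_smul, Set.mem_ofPred_eq, Set.mem_singleton_iff]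
      exact map_eq_zero_iff _ p.map_injective
    rw [h1, Set.ncard_singleton] at ha
    exact absurd ha (not_lt.2 (Nat.one_le_pow _ _ (by omega)))
  have h1 : p.1 = 1 := by
    by_contra h
    have h2 := p.card_eigenvectors_sq_le h ha0
    have h3 : (Fintype.card F ^ (3 * n / 4)) ^ 2 < Fintype.card F ^ n :=
      (Nat.pow_lt_pow_left ha two_ne_zero).trans_le h2
    rw [← pow_mul, Nat.pow_lt_pow_iff_right hq] at h3
    omega
  refine ⟨h1, Units.mk0 a ha0, ?_⟩
  have h2 := LinearMap.finrank_range_add_finrank_ker (monSub p.2.1 p.2.2 (Units.mk0 a ha0))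
  rw [Module.finrank_fin_fun] at h2
  have h3 : {v : Fin n → F | p.map v = a • v}
      = (LinearMap.ker (monSub p.2.1 p.2.2 (Units.mk0 a ha0)) : Set (Fin n → F)) := by
    ext v
    simp [SemiMon.map_eq_monSub_add h1 (Units.mk0 a ha0)]
  rw [h3, card_coe_submodule, Nat.pow_lt_pow_iff_right hq] at ha
  omega

/-- Bound for the number of invariant subspaces of a non-scalar transformation. -/
lemma SemiMon.card_invSubspaces_le [Fintype F] (hn : 2 ≤ n) (p : SemiMon F n) (hp : ¬ p.IsScalar)
    {k : ℕ} (hk1 : 3 * n ≤ 8 * k) (hk2 : 8 * k ≤ 5 * n) (J : ℕ) :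
    ((invSubspaces F p.map k).ncard : ℝ) ≤ qBinom (Fintype.card F) n k *
        ((Fintype.card F : ℝ) ^ (3 + 2 * (J : ℝ) - (n : ℝ) / 4)) ^ J ∨
      p.1 = 1 ∧ ∃ a : Fˣ, p.2 ≠ (1, fun _ => a) ∧
        ((invSubspaces F p.map k).ncard : ℝ) ≤ qBinom (Fintype.card F) n k *
          (2 * ((Fintype.card F : ℝ) ^ (-((n : ℝ) / 32))) ^ (monSupport p.2.1 p.2.2 a).card) := by
  by_cases hc : ∀ a : F, {v : Fin n → F | p.map v = a • v}.ncard ≤ Fintype.card F ^ (3 * n / 4)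
  · left
    have h := card_invSubspaces_le_of_card_eigenvectors (k := k) (J := J) p.map hc
    rw [Module.finrank_fin_fun] at h
    exact h (by omega) (by omega) (by omega)
  · right
    have hq := one_lt_cast_card F
    obtain ⟨h1, a, ha⟩ := p.exists_rank_le_of_card_eigenvectors hn hc
    have hne : p.2 ≠ (1, fun _ => a) := fun h => hp ⟨h1, a, h⟩
    refine ⟨h1, a, hne, ?_⟩
    have ht := card_monSupport_le p.2.1 p.2.2 a
    have ht0 : 1 ≤ (monSupport p.2.1 p.2.2 a).card := by
      rw [Nat.one_le_iff_ne_zero, Ne, Finset.card_eq_zero]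
      intro h0
      refine hne (Prod.ext (Equiv.ext fun i => ?_) (funext fun i => ?_))
      all_goals
        have := mem_monSupport.not.1 (Finset.eq_empty_iff_forall_notMem.1 h0 i)
        push Not at this
      · exact congrArg Prod.fst this
      · exact congrArg Prod.snd this
    have h := card_invSubspaces_le_of_rank (k := k) (monSub p.2.1 p.2.2 a)
    rw [Module.finrank_fin_fun] at h
    have h2 : invSubspaces F p.map k = invSubspaces F (monSub p.2.1 p.2.2 a) k := by
      ext W
      refine and_congr_right fun _ => forall₂_congr fun v hv => ?_
      rw [SemiMon.map_eq_monSub_add h1 a]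
      exact W.add_mem_iff_left (W.smul_mem _ hv)
    rw [h2]
    refine (h ha (by omega) (by omega) (by omega)).trans ?_
    refine mul_le_mul_of_nonneg_left (mul_le_mul_of_nonneg_left ?_ zero_le_two)
      (qBinom_pos Fintype.one_lt_card (by omega)).le
    rw [← Real.rpow_natCast, ← Real.rpow_mul (by linarith)]
    refine Real.rpow_le_rpow_of_exponent_le hq.le ?_
    have ht' : ((monSupport p.2.1 p.2.2 a).card : ℝ)
        ≤ 2 * Module.finrank F (LinearMap.range (monSub p.2.1 p.2.2 a)) := by exact_mod_cast ht
    have hn0 : (0 : ℝ) ≤ n := by positivity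
    nlinarith

open Classical in
lemma sum_pow_card_monSupport_le [Fintype F] (a : Fˣ) {x : ℝ} (hx : 0 ≤ x) :
    ∑ y ∈ Finset.univ.filter (fun y : Equiv.Perm (Fin n) × (Fin n → Fˣ) => y ≠ (1, fun _ => a)),
        x ^ (monSupport y.1 y.2 a).card
      ≤ (1 + n * Fintype.card F * x) ^ n - 1 := by
  have h1 : ∑ y : Equiv.Perm (Fin n) × (Fin n → Fˣ), x ^ (monSupport y.1 y.2 a).card
      ≤ (1 + n * Fintype.card F * x) ^ n := by
    calc ∑ y : Equiv.Perm (Fin n) × (Fin n → Fˣ), x ^ (monSupport y.1 y.2 a).card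
        = ∑ y : Equiv.Perm (Fin n) × (Fin n → Fˣ),
            ∏ i, (if (y.1 i, y.2 i) ≠ (i, a) then x else 1) := by
          refine Finset.sum_congr rfl fun y _ => ?_
          rw [monSupport, ← Finset.prod_const, Finset.prod_filter]
      _ = ∑ f ∈ Finset.univ.image (fun (y : Equiv.Perm (Fin n) × (Fin n → Fˣ)) (i : Fin n) =>
            (y.1 i, y.2 i)), ∏ i, (if f i ≠ (i, a) then x else 1) := by
          rw [Finset.sum_image]
          rintro y _ z _ h
          refine Prod.ext (Equiv.ext fun i => ?_) (funext fun i => ?_)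
          · exact congrArg Prod.fst (congrFun h i)
          · exact congrArg Prod.snd (congrFun h i)
      _ ≤ ∑ f : Fin n → Fin n × Fˣ, ∏ i, (if f i ≠ (i, a) then x else 1) := by
          refine Finset.sum_le_sum_of_subset_of_nonneg (Finset.subset_univ _) fun f _ _ => ?_
          exact Finset.prod_nonneg fun i _ => by split_ifs <;> positivity
      _ = ∏ i : Fin n, ∑ b : Fin n × Fˣ, (if b ≠ (i, a) then x else 1) := by
          rw [Finset.prod_univ_sum, Fintype.piFinset_univ]
      _ ≤ ∏ _i : Fin n, (1 + n * Fintype.card F * x) := by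
          refine Finset.prod_le_prod
            (fun i _ => Finset.sum_nonneg fun b _ => by split_ifs <;> positivity) fun i _ => ?_
          calc ∑ b : Fin n × Fˣ, (if b ≠ (i, a) then x else 1)
              ≤ ∑ b : Fin n × Fˣ, ((if b = (i, a) then 1 else 0) + x) := by
                refine Finset.sum_le_sum fun b _ => ?_
                by_cases hb : b = (i, a) <;> simp [hb, hx]
            _ = 1 + (n * Fintype.card Fˣ : ℕ) * x := by
                rw [Finset.sum_add_distrib, Finset.sum_ite_eq' Finset.univ, Finset.sum_const]
                simp
            _ ≤ 1 + n * Fintype.card F * x := by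
                have : (Fintype.card Fˣ : ℝ) ≤ Fintype.card F := by
                  exact_mod_cast Fintype.card_le_of_injective _ Units.val_injective
                push_cast
                gcongr
      _ = _ := by rw [Finset.prod_const, Finset.card_univ, Fintype.card_fin]
  have h2 : monSupport (1 : Equiv.Perm (Fin n)) (fun _ => a) a = ∅ := by
    simp [monSupport]
  rw [← Finset.add_sum_erase _ _
    (Finset.mem_univ ((1, fun _ => a) : Equiv.Perm (Fin n) × (Fin n → Fˣ)))] at h1
  rw [h2, Finset.card_empty, pow_zero] at h1
  rw [Finset.filter_ne']
  linarith

instance [Finite F] : Finite (F ≃+* F) :=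
  Finite.of_injective (fun e : F ≃+* F => (e : F → F)) DFunLike.coe_injective

open Classical in
/-- The total number of subspaces fixed by non-scalar semilinear monomial transformations. -/
noncomputable def fixTotal (F : Type) [Field F] [Fintype F] (n k : ℕ) : ℝ :=
  ∑ᶠ p ∈ {p : SemiMon F n | ¬ p.IsScalar}, ((invSubspaces F p.map k).ncard : ℝ)

/-- Relative error term, for a parameter `J` to be optimised. -/
noncomputable def fixError (F : Type) [Field F] [Fintype F] (n J : ℕ) : ℝ :=
  Nat.card (SemiMon F n) * ((Fintype.card F : ℝ) ^ (3 + 2 * (J : ℝ) - (n : ℝ) / 4)) ^ J +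
    Fintype.card F * (2 * ((1 + n * Fintype.card F * (Fintype.card F : ℝ) ^ (-((n : ℝ) / 32))) ^ n
      - 1))

lemma fixTotal_le_of_middle [Fintype F] (hn : 2 ≤ n) {k : ℕ} (hk1 : 3 * n ≤ 8 * k)
    (hk2 : 8 * k ≤ 5 * n) (J : ℕ) :
    fixTotal F n k ≤ qBinom (Fintype.card F) n k * fixError F n J := by
  classical
  have := Fintype.ofFinite (F ≃+* F)
  have hq := one_lt_cast_card F
  have hg := qBinom_pos (r := Fintype.card F) (n := n) (k := k) Fintype.one_lt_card (by omega)
  set g := qBinom (Fintype.card F) n k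
  set c := ((Fintype.card F : ℝ) ^ (3 + 2 * (J : ℝ) - (n : ℝ) / 4)) ^ J with hc
  set x := (Fintype.card F : ℝ) ^ (-((n : ℝ) / 32)) with hx
  have hx0 : 0 ≤ x := by positivity
  have hc0 : 0 ≤ c := by positivity
  let φ (p : SemiMon F n) (a : Fˣ) : ℝ :=
    if p.1 = 1 ∧ p.2 ≠ (1, fun _ => a) then 2 * x ^ (monSupport p.2.1 p.2.2 a).card else 0
  have hφ (p : SemiMon F n) (a : Fˣ) : 0 ≤ φ p a := by
    simp only [φ]; split_ifs <;> positivity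
  have h1 (p : SemiMon F n) (hp : ¬ p.IsScalar) :
      ((invSubspaces F p.map k).ncard : ℝ) ≤ g * (c + ∑ a, φ p a) := by
    rcases p.card_invSubspaces_le hn hp hk1 hk2 J with h | ⟨h1, a, ha, h⟩
    · refine h.trans (mul_le_mul_of_nonneg_left ?_ hg.le)
      exact le_add_of_nonneg_right (Finset.sum_nonneg fun a _ => hφ p a)
    · refine h.trans (mul_le_mul_of_nonneg_left ?_ hg.le)
      refine le_trans ?_ (le_add_of_nonneg_left hc0)
      refine le_trans (le_of_eq ?_)
        (Finset.single_le_sum (fun a _ => hφ p a) (Finset.mem_univ a))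
      simp only [φ]
      rw [if_pos ⟨h1, ha⟩]
  have h2 : ∑ p : SemiMon F n, ∑ a, φ p a
      ≤ Fintype.card F * (2 * ((1 + n * Fintype.card F * x) ^ n - 1)) := by
    rw [Finset.sum_comm]
    have h3 (a : Fˣ) : ∑ p : SemiMon F n, φ p a ≤ 2 * ((1 + n * Fintype.card F * x) ^ n - 1) := by
      rw [Fintype.sum_prod_type, Finset.sum_eq_single (1 : F ≃+* F)]
      · have h4 := sum_pow_card_monSupport_le (n := n) a hx0
        rw [Finset.sum_filter] at h4
        refine le_trans (le_of_eq ?_) (mul_le_mul_of_nonneg_left h4 zero_le_two)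
        rw [Finset.mul_sum]
        refine Finset.sum_congr rfl fun y _ => ?_
        by_cases hy : y = (1, fun _ => a) <;> simp [φ, hy]
      · intro σ _ hσ
        exact Finset.sum_eq_zero fun y _ => if_neg fun h => hσ h.1
      · simp
    refine (Finset.sum_le_sum fun a _ => h3 a).trans ?_
    rw [Finset.sum_const, nsmul_eq_mul]
    have h5 : (Fintype.card Fˣ : ℝ) ≤ Fintype.card F := by
      exact_mod_cast Fintype.card_le_of_injective _ Units.val_injective
    refine mul_le_mul_of_nonneg_right h5 (mul_nonneg zero_le_two (sub_nonneg.2 (one_le_pow₀ ?_)))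
    exact le_add_of_nonneg_right (by positivity)
  calc fixTotal F n k
      = ∑ p ∈ Finset.univ.filter (fun p : SemiMon F n => ¬ p.IsScalar),
          ((invSubspaces F p.map k).ncard : ℝ) := by
        rw [fixTotal, ← finsum_mem_coe_finset]
        simp
    _ ≤ ∑ p ∈ Finset.univ.filter (fun p : SemiMon F n => ¬ p.IsScalar), g * (c + ∑ a, φ p a) :=
        Finset.sum_le_sum fun p hp => h1 p (Finset.mem_filter.1 hp).2
    _ ≤ ∑ p : SemiMon F n, g * (c + ∑ a, φ p a) := by
        refine Finset.sum_le_sum_of_subset_of_nonneg (Finset.subset_univ _) fun p _ _ => ?_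
        exact mul_nonneg hg.le (add_nonneg hc0 (Finset.sum_nonneg fun a _ => hφ p a))
    _ ≤ _ := by
        rw [← Finset.mul_sum, Finset.sum_add_distrib, Finset.sum_const, nsmul_eq_mul, fixError,
          Nat.card_eq_fintype_card, Finset.card_univ]
        exact mul_le_mul_of_nonneg_left (add_le_add_right h2 _) hg.le

lemma fixTotal_le [Fintype F] {k : ℕ} (hk : k ≤ n) :
    fixTotal F n k ≤ Nat.card (SemiMon F n) * qBinom (Fintype.card F) n k := by
  classical
  have := Fintype.ofFinite (F ≃+* F)
  have h1 (p : SemiMon F n) :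
      ((invSubspaces F p.map k).ncard : ℝ) ≤ qBinom (Fintype.card F) n k := by
    have h := card_submodule_eq_qBinom (F := F) (V := Fin n → F) (k := k)
      (by rwa [Module.finrank_fin_fun])
    rw [Module.finrank_fin_fun] at h
    rw [← h, Nat.cast_le]
    exact Set.ncard_le_ncard (fun W hW => hW.1) (Set.toFinite _)
  calc fixTotal F n k
      = ∑ p ∈ Finset.univ.filter (fun p : SemiMon F n => ¬ p.IsScalar),
          ((invSubspaces F p.map k).ncard : ℝ) := by
        rw [fixTotal, ← finsum_mem_coe_finset]
        simp
    _ ≤ ∑ p : SemiMon F n, ((invSubspaces F p.map k).ncard : ℝ) :=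
        Finset.sum_le_sum_of_subset_of_nonneg (Finset.subset_univ _) fun p _ _ => by positivity
    _ ≤ ∑ p : SemiMon F n, qBinom (Fintype.card F) n k := Finset.sum_le_sum fun p _ => h1 p
    _ = _ := by
        rw [Finset.sum_const, nsmul_eq_mul, Nat.card_eq_fintype_card, Finset.card_univ]

end SemilinearMonomial

section Orbits

variable {F : Type} [Field F] {n : ℕ}

/-- Composition of semilinear monomial transformations, on data. -/
def SemiMon.comp (p r : SemiMon F n) : SemiMon F n :=
  (p.1 * r.1, r.2.1 * p.2.1,
    fun i => p.2.2 i * Units.map (p.1 : F →* F) (r.2.2 (p.2.1 i)))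

lemma SemiMon.map_comp (p r : SemiMon F n) (x : Fin n → F) :
    (p.comp r).map x = p.map (r.map x) := by
  ext i
  simp [SemiMon.map_apply, SemiMon.comp, mul_assoc]

/-- The image of a subspace under a semilinear monomial transformation. -/
def SemiMon.act (p : SemiMon F n) (W : Submodule F (Fin n → F)) : Submodule F (Fin n → F) :=
  { W.toAddSubmonoid.map (p.map : (Fin n → F) →+ (Fin n → F)) with
    smul_mem' := by
      rintro c _ ⟨x, hx, rfl⟩
      exact ⟨p.1.symm c • x, W.smul_mem _ hx, by simp [SemiMon.map_smul]⟩ }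

lemma SemiMon.coe_act (p : SemiMon F n) (W : Submodule F (Fin n → F)) :
    (p.act W : Set (Fin n → F)) = p.map '' W := rfl

lemma SemiMon.act_eq_iff {p : SemiMon F n} {W W' : Submodule F (Fin n → F)} :
    p.act W = W' ↔ (W' : Set (Fin n → F)) = p.map '' W := by
  rw [← SetLike.coe_set_eq, SemiMon.coe_act, eq_comm]

lemma SemiMon.act_comp (p r : SemiMon F n) (W : Submodule F (Fin n → F)) :
    (p.comp r).act W = p.act (r.act W) := by
  rw [SemiMon.act_eq_iff, SemiMon.coe_act, SemiMon.coe_act, Set.image_image]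
  simp only [SemiMon.map_comp]

lemma SemiMon.act_injective (p : SemiMon F n) : Function.Injective p.act := by
  intro W W' h
  rw [SemiMon.act_eq_iff, SemiMon.coe_act] at h
  exact SetLike.coe_injective (p.map_injective.image_injective h).symm

lemma SemiMon.act_eq_self_of_isScalar {p : SemiMon F n} (hp : p.IsScalar)
    (W : Submodule F (Fin n → F)) : p.act W = W := by
  obtain ⟨σ, π, d⟩ := p
  obtain ⟨h1, a, h2⟩ := hp
  obtain rfl : σ = 1 := h1
  obtain ⟨rfl, rfl⟩ := Prod.ext_iff.1 h2
  have h (x : Fin n → F) : SemiMon.map ((1, 1, fun _ => a) : SemiMon F n) x = (a : F) • x := by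
    ext i
    simp [SemiMon.map_apply]
  rw [SemiMon.act_eq_iff]
  ext x
  simp only [h, Set.mem_image, SetLike.mem_coe]
  refine ⟨fun hx => ⟨(a : F)⁻¹ • x, W.smul_mem _ hx, by simp⟩, ?_⟩
  rintro ⟨y, hy, rfl⟩
  exact W.smul_mem _ hy

lemma SemiMon.finrank_act [Fintype F] (p : SemiMon F n) (W : Submodule F (Fin n → F)) :
    Module.finrank F (p.act W) = Module.finrank F W := by
  have h := Set.ncard_image_of_injective (W : Set (Fin n → F)) p.map_injective
  rw [← SemiMon.coe_act, card_coe_submodule, card_coe_submodule] at h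
  exact Nat.pow_right_injective Fintype.one_lt_card h

/-- The permutation of the subspaces induced by a semilinear monomial transformation. -/
noncomputable def SemiMon.toPerm [Fintype F] (p : SemiMon F n) :
    Equiv.Perm (Submodule F (Fin n → F)) :=
  Equiv.ofBijective p.act (Finite.injective_iff_bijective.1 p.act_injective)

lemma SemiMon.toPerm_apply [Fintype F] (p : SemiMon F n) (W : Submodule F (Fin n → F)) :
    p.toPerm W = p.act W := rfl

/-- A set of semilinear monomial transformations closed under composition. -/
structure SemiMonClosed (P : Set (SemiMon F n)) : Prop where
  one_mem : (1, 1, 1) ∈ P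
  comp_mem : ∀ p ∈ P, ∀ r ∈ P, p.comp r ∈ P

/-- The group of permutations of the subspaces induced by a closed set of transformations. -/
noncomputable def SemiMonClosed.subgroup [Fintype F] {P : Set (SemiMon F n)}
    (hP : SemiMonClosed P) : Subgroup (Equiv.Perm (Submodule F (Fin n → F))) :=
  let M : Submonoid (Equiv.Perm (Submodule F (Fin n → F))) :=
    { carrier := SemiMon.toPerm '' P
      one_mem' := ⟨_, hP.one_mem, Equiv.ext fun W =>
        SemiMon.act_eq_self_of_isScalar ⟨rfl, 1, rfl⟩ W⟩
      mul_mem' := by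
        rintro _ _ ⟨p, hp, rfl⟩ ⟨r, hr, rfl⟩
        exact ⟨p.comp r, hP.comp_mem p hp r hr, Equiv.ext fun W => p.act_comp r W⟩ }
  { M with
    inv_mem' := by
      intro x hx
      obtain ⟨k, hk⟩ := (mem_powers_iff_mem_zpowers (x := x) (y := x⁻¹)).2
        (Subgroup.inv_mem _ (Subgroup.mem_zpowers x))
      exact hk ▸ M.pow_mem hx k }

lemma SemiMonClosed.mem_subgroup [Fintype F] {P : Set (SemiMon F n)} (hP : SemiMonClosed P)
    {x : Equiv.Perm (Submodule F (Fin n → F))} : x ∈ hP.subgroup ↔ ∃ p ∈ P, p.toPerm = x :=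
  Iff.rfl

/-- Burnside's lemma for the quotient by an explicit orbit relation. -/
lemma card_quot_mul_card_group {G X : Type*} [Group G] [MulAction G X] [Fintype G] [Finite X]
    (r : X → X → Prop) (hr : ∀ x y, r x y ↔ ∃ g : G, g • x = y) :
    Nat.card (Quot r) * Nat.card G = ∑ g : G, Nat.card (MulAction.fixedBy X g) := by
  classical
  have := Fintype.ofFinite X
  have := Fintype.ofFinite (Quotient (MulAction.orbitRel G X))
  have h := MulAction.sum_card_fixedBy_eq_card_orbits_mul_card_group G X
  have e : Quot r ≃ Quotient (MulAction.orbitRel G X) :=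
    Quot.congrRight fun x y => by
      rw [hr]
      exact (MulAction.mem_orbit_iff (a₁ := x)).symm.trans (MulAction.orbitRel G X).comm'
  simp only [Nat.card_congr e, Nat.card_eq_fintype_card]
  exact h.symm

/-- The number of orbits of a set of transformations on the `k`-dimensional subspaces. -/
noncomputable def orbitsDim (P : Set (SemiMon F n)) (k : ℕ) : ℕ :=
  Nat.card (Quot (fun V W : {V : Submodule F (Fin n → F) // Module.finrank F V = k} =>
    ∃ p ∈ P, p.act V.1 = W.1))

/-- The number of orbits of a set of transformations on all subspaces. -/
noncomputable def orbits (P : Set (SemiMon F n)) : ℕ :=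
  Nat.card (Quot (fun V W : Submodule F (Fin n → F) => ∃ p ∈ P, p.act V = W))

lemma SemiMonClosed.orbits_mul_card [Fintype F] {P : Set (SemiMon F n)} (hP : SemiMonClosed P)
    [Fintype hP.subgroup] :
    orbits P * Nat.card hP.subgroup
      = ∑ x : hP.subgroup, {W : Submodule F (Fin n → F) | x.1 W = W}.ncard := by
  refine (card_quot_mul_card_group (G := hP.subgroup) _ fun V W => ?_).trans ?_
  · constructor
    · rintro ⟨p, hp, h⟩
      exact ⟨⟨p.toPerm, p, hp, rfl⟩, h⟩
    · rintro ⟨⟨_, p, hp, rfl⟩, h⟩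
      exact ⟨p, hp, h⟩
  · exact Finset.sum_congr rfl fun x _ => Nat.card_coe_set_eq _

lemma SemiMonClosed.orbitsDim_mul_card [Fintype F] {P : Set (SemiMon F n)}
    (hP : SemiMonClosed P) [Fintype hP.subgroup] (k : ℕ) :
    orbitsDim P k * Nat.card hP.subgroup
      = ∑ x : hP.subgroup,
          {W : Submodule F (Fin n → F) | Module.finrank F W = k ∧ x.1 W = W}.ncard := by
  let X : SubMulAction hP.subgroup (Submodule F (Fin n → F)) :=
    { carrier := {V | Module.finrank F V = k}
      smul_mem' := by
        rintro ⟨_, p, hp, rfl⟩ V hV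
        exact (p.finrank_act V).trans hV }
  refine (card_quot_mul_card_group (G := hP.subgroup) (X := X) _ fun V W => ?_).trans ?_
  · constructor
    · rintro ⟨p, hp, h⟩
      exact ⟨⟨p.toPerm, p, hp, rfl⟩, Subtype.ext h⟩
    · rintro ⟨⟨_, p, hp, rfl⟩, h⟩
      exact ⟨p, hp, congrArg Subtype.val h⟩
  · refine Finset.sum_congr rfl fun x _ => ?_
    rw [← Nat.card_coe_set_eq]
    exact Nat.card_congr
      { toFun := fun V => ⟨V.1.1, V.1.2, congrArg Subtype.val V.2⟩
        invFun := fun V => ⟨⟨V.1, V.2.1⟩, Subtype.ext V.2.2⟩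
        left_inv := fun _ => rfl
        right_inv := fun _ => rfl }

lemma SemiMonClosed.orbits_eq_sum [Fintype F] {P : Set (SemiMon F n)} (hP : SemiMonClosed P) :
    orbits P = ∑ k ∈ Finset.range (n + 1), orbitsDim P k := by
  classical
  have := Fintype.ofFinite hP.subgroup
  refine Nat.eq_of_mul_eq_mul_right (Nat.card_pos (α := hP.subgroup)) ?_
  rw [Finset.sum_mul, hP.orbits_mul_card]
  simp only [hP.orbitsDim_mul_card]
  rw [Finset.sum_comm]
  refine Finset.sum_congr rfl fun x _ => ?_
  have := Fintype.ofFinite (Submodule F (Fin n → F))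
  simp only [Set.ncard_eq_toFinset_card']
  rw [Finset.card_eq_sum_card_fiberwise (f := fun W : Submodule F (Fin n → F) =>
    Module.finrank F W) (t := Finset.range (n + 1))]
  · refine Finset.sum_congr rfl fun k _ => congrArg Finset.card ?_
    ext W
    simp [and_comm]
  · intro W _
    have := Submodule.finrank_le W
    rw [Module.finrank_fin_fun] at this
    simpa using Nat.lt_succ_of_le this

/-- The number of orbits is the number of subspaces divided by the order of the group, up to
the number of subspaces fixed by non-scalar transformations. -/
lemma SemiMonClosed.orbitsDim_bounds [Fintype F] {P : Set (SemiMon F n)}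
    (hP : SemiMonClosed P) {k : ℕ} (hk : k ≤ n) :
    qBinom (Fintype.card F) n k ≤ Nat.card hP.subgroup * (orbitsDim P k : ℝ) ∧
      Nat.card hP.subgroup * (orbitsDim P k : ℝ)
        ≤ qBinom (Fintype.card F) n k + fixTotal F n k := by
  classical
  have := Fintype.ofFinite hP.subgroup
  have := Fintype.ofFinite (F ≃+* F)
  have h := congrArg (Nat.cast (R := ℝ)) (hP.orbitsDim_mul_card k)
  rw [← Finset.add_sum_erase _ _ (Finset.mem_univ (1 : hP.subgroup))] at h
  rw [Nat.cast_mul, Nat.cast_add, Nat.cast_sum] at h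
  have h1 : (({W : Submodule F (Fin n → F) | Module.finrank F W = k ∧
      (1 : hP.subgroup).1 W = W}.ncard : ℕ) : ℝ) = qBinom (Fintype.card F) n k := by
    have h2 := card_submodule_eq_qBinom (F := F) (V := Fin n → F) (k := k)
      (by rwa [Module.finrank_fin_fun])
    rw [Module.finrank_fin_fun] at h2
    rw [← h2]
    simp
  rw [h1] at h
  rw [mul_comm, h]
  refine ⟨le_add_of_nonneg_right (Finset.sum_nonneg fun _ _ => by positivity),
    add_le_add_right ?_ _⟩
  choose f _ hf using fun x : hP.subgroup => hP.mem_subgroup.1 x.2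
  have hinj : Function.Injective f := fun x y hxy => Subtype.ext (by rw [← hf x, hxy, hf y])
  calc ∑ x ∈ Finset.univ.erase (1 : hP.subgroup),
        (({W : Submodule F (Fin n → F) | Module.finrank F W = k ∧ x.1 W = W}.ncard : ℕ) : ℝ)
      ≤ ∑ x ∈ Finset.univ.erase (1 : hP.subgroup),
          ((invSubspaces F (f x).map k).ncard : ℝ) := by
        refine Finset.sum_le_sum fun x _ => Nat.cast_le.2 (Set.ncard_le_ncard ?_ (Set.toFinite _))
        rintro W ⟨hW, hx⟩
        refine ⟨hW, fun v hv => ?_⟩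
        rw [← hf x, SemiMon.toPerm_apply, SemiMon.act_eq_iff] at hx
        rw [← SetLike.mem_coe, hx]
        exact Set.mem_image_of_mem _ hv
    _ = ∑ p ∈ (Finset.univ.erase (1 : hP.subgroup)).image f,
          ((invSubspaces F p.map k).ncard : ℝ) := by
        rw [Finset.sum_image hinj.injOn]
    _ ≤ ∑ p ∈ Finset.univ.filter (fun p : SemiMon F n => ¬ p.IsScalar),
          ((invSubspaces F p.map k).ncard : ℝ) := by
        refine Finset.sum_le_sum_of_subset_of_nonneg ?_ fun _ _ _ => by positivity
        intro p hp
        obtain ⟨x, hx, rfl⟩ := Finset.mem_image.1 hp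
        refine Finset.mem_filter.2 ⟨Finset.mem_univ _, fun hs => (Finset.mem_erase.1 hx).1 ?_⟩
        refine Subtype.ext (Equiv.ext fun W => ?_)
        rw [← hf x, SemiMon.toPerm_apply, SemiMon.act_eq_self_of_isScalar hs]
        rfl
    _ = fixTotal F n k := by
        rw [fixTotal, ← finsum_mem_coe_finset]
        simp

end Orbits

section Groups

variable (F : Type) [Field F] (n : ℕ)

/-- The transformations permuting the coordinates. -/
def permMon : Set (SemiMon F n) := {p | p.1 = 1 ∧ p.2.2 = 1}

/-- The linear monomial transformations. -/
def linearMon : Set (SemiMon F n) := {p | p.1 = 1}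

lemma permMon_closed : SemiMonClosed (permMon F n) where
  one_mem := ⟨rfl, rfl⟩
  comp_mem := by
    rintro ⟨_, _, _⟩ ⟨rfl, rfl⟩ ⟨_, _, _⟩ ⟨rfl, rfl⟩
    exact ⟨rfl, funext fun i => by simp [SemiMon.comp]⟩

lemma linearMon_closed : SemiMonClosed (linearMon F n) where
  one_mem := rfl
  comp_mem := by
    rintro ⟨_, _, _⟩ rfl ⟨_, _, _⟩ rfl
    rfl

lemma univ_closed : SemiMonClosed (Set.univ : Set (SemiMon F n)) where
  one_mem := trivial
  comp_mem _ _ _ _ := trivial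

variable {F n}

/-- The inverse of a linear monomial transformation, on data. -/
def SemiMon.linearInv (p : SemiMon F n) : SemiMon F n :=
  (1, p.2.1⁻¹, fun i => (p.2.2 (p.2.1⁻¹ i))⁻¹)

lemma SemiMon.linearInv_map_map {p : SemiMon F n} (hp : p.1 = 1) (x : Fin n → F) :
    p.linearInv.map (p.map x) = x := by
  ext i
  simp [SemiMon.map_apply, SemiMon.linearInv, hp]

lemma permMon_linearInv {p : SemiMon F n} (hp : p ∈ permMon F n) :
    p.linearInv ∈ permMon F n := by
  obtain ⟨_, _, _⟩ := p
  obtain ⟨rfl, rfl⟩ := hp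
  exact ⟨rfl, funext fun i => by simp [SemiMon.linearInv]⟩

/-- The elements of a subgroup of `GL n F` generated by matrices acting by a set of monomial
transformations closed under composition and inversion act by such transformations. -/
lemma exists_map_eq_mulVec_of_mem_closure {P : Set (SemiMon F n)} (hP : SemiMonClosed P)
    (h1 : P ⊆ linearMon F n) (hinv : ∀ p ∈ P, p.linearInv ∈ P) {S : Set (GL (Fin n) F)}
    (hS : ∀ M ∈ S, ∃ p ∈ P, ∀ x, (M : Matrix (Fin n) (Fin n) F) *ᵥ x = p.map x)
    {M : GL (Fin n) F} (hM : M ∈ Subgroup.closure S) :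
    ∃ p ∈ P, ∀ x, (M : Matrix (Fin n) (Fin n) F) *ᵥ x = p.map x := by
  induction hM using Subgroup.closure_induction with
  | mem M hM => exact hS M hM
  | one => exact ⟨_, hP.one_mem, fun x => by ext; simp [SemiMon.map_apply]⟩
  | mul M N _ _ hM hN =>
    obtain ⟨p, hp, hpx⟩ := hM
    obtain ⟨r, hr, hrx⟩ := hN
    refine ⟨p.comp r, hP.comp_mem p hp r hr, fun x => ?_⟩
    rw [SemiMon.map_comp, ← hrx, ← hpx, Units.val_mul, Matrix.mulVec_mulVec]
  | inv M _ hM =>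
    obtain ⟨p, hp, hpx⟩ := hM
    refine ⟨p.linearInv, hinv p hp, fun x => ?_⟩
    rw [← SemiMon.linearInv_map_map (h1 hp) ((M⁻¹ : GL (Fin n) F).1 *ᵥ x), ← hpx,
      Matrix.mulVec_mulVec, ← Units.val_mul, mul_inv_cancel, Units.val_one, Matrix.one_mulVec]

lemma permMatrix_mulVec_eq_map (π : Equiv.Perm (Fin n)) (x : Fin n → F) :
    π.permMatrix F *ᵥ x = SemiMon.map ((1, π, 1) : SemiMon F n) x := by
  ext i
  simp [SemiMon.map_apply, Matrix.permMatrix_mulVec]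

lemma diagonal_mulVec_eq_map (d : Fin n → Fˣ) (x : Fin n → F) :
    Matrix.diagonal (fun i => (d i : F)) *ᵥ x = SemiMon.map ((1, 1, d) : SemiMon F n) x := by
  ext i
  simp [SemiMon.map_apply, Matrix.mulVec_diagonal]

lemma exists_of_mem_permSet {M : GL (Fin n) F} (hM : M ∈ permSet F n) :
    ∃ p ∈ permMon F n, ∀ x, (M : Matrix (Fin n) (Fin n) F) *ᵥ x = p.map x := by
  obtain ⟨π, hπ⟩ := hM
  exact ⟨(1, π, 1), ⟨rfl, rfl⟩, fun x => by rw [hπ, permMatrix_mulVec_eq_map]⟩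

lemma exists_of_mem_diagSet {M : GL (Fin n) F} (hM : M ∈ diagSet F n) :
    ∃ p ∈ linearMon F n, ∀ x, (M : Matrix (Fin n) (Fin n) F) *ᵥ x = p.map x := by
  obtain ⟨d, hd⟩ := hM
  have h0 (i : Fin n) : d i ≠ 0 := by
    have h := ((Matrix.isUnit_iff_isUnit_det _).1 M.isUnit).ne_zero
    rw [hd, Matrix.det_diagonal] at h
    exact Finset.prod_ne_zero_iff.1 h i (Finset.mem_univ i)
  refine ⟨(1, 1, fun i => Units.mk0 (d i) (h0 i)), rfl, fun x => ?_⟩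
  rw [← diagonal_mulVec_eq_map, hd]
  rfl

lemma exists_mem_permSet (π : Equiv.Perm (Fin n)) :
    ∃ M ∈ permSet F n, (M : Matrix (Fin n) (Fin n) F) = π.permMatrix F := by
  refine ⟨Matrix.GeneralLinearGroup.mkOfDetNeZero (π.permMatrix F) ?_, ⟨π, rfl⟩, rfl⟩
  rw [Matrix.det_permutation]
  rcases Int.units_eq_one_or (Equiv.Perm.sign π) with h | h <;> simp [h]

lemma exists_mem_diagSet (d : Fin n → Fˣ) :
    ∃ M ∈ diagSet F n, (M : Matrix (Fin n) (Fin n) F) = Matrix.diagonal fun i => (d i : F) := by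
  refine ⟨Matrix.GeneralLinearGroup.mkOfDetNeZero (Matrix.diagonal fun i => (d i : F)) ?_,
    ⟨_, rfl⟩, rfl⟩
  rw [Matrix.det_diagonal]
  exact Finset.prod_ne_zero_iff.2 fun i _ => (d i).ne_zero

lemma exists_mem_PermGroup {p : SemiMon F n} (hp : p ∈ permMon F n) :
    ∃ M ∈ PermGroup F n, ∀ x, (M : Matrix (Fin n) (Fin n) F) *ᵥ x = p.map x := by
  obtain ⟨_, π, _⟩ := p
  obtain ⟨rfl, rfl⟩ := hp
  obtain ⟨M, hM, h⟩ := exists_mem_permSet (F := F) π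
  exact ⟨M, Subgroup.subset_closure hM, fun x => by rw [h, permMatrix_mulVec_eq_map]⟩

lemma exists_mem_MonomialGroup (π : Equiv.Perm (Fin n)) (d : Fin n → Fˣ) :
    ∃ M ∈ MonomialGroup F n, ∀ x, (M : Matrix (Fin n) (Fin n) F) *ᵥ x
      = SemiMon.map ((1, π, d) : SemiMon F n) x := by
  obtain ⟨M, hM, h⟩ := exists_mem_permSet (F := F) π
  obtain ⟨N, hN, h'⟩ := exists_mem_diagSet d
  refine ⟨N * M, Subgroup.mul_mem _ (Subgroup.subset_closure (Or.inr hN))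
    (Subgroup.subset_closure (Or.inl hM)), fun x => ?_⟩
  rw [Units.val_mul, ← Matrix.mulVec_mulVec, h, h', permMatrix_mulVec_eq_map,
    diagonal_mulVec_eq_map]
  ext i
  simp [SemiMon.map_apply]

lemma exists_of_mem_PermGroup {M : GL (Fin n) F} (hM : M ∈ PermGroup F n) :
    ∃ p ∈ permMon F n, ∀ x, (M : Matrix (Fin n) (Fin n) F) *ᵥ x = p.map x :=
  exists_map_eq_mulVec_of_mem_closure (permMon_closed F n) (fun _ hp => hp.1)
    (fun _ => permMon_linearInv) (fun _ => exists_of_mem_permSet) hM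

lemma exists_of_mem_MonomialGroup {M : GL (Fin n) F} (hM : M ∈ MonomialGroup F n) :
    ∃ p ∈ linearMon F n, ∀ x, (M : Matrix (Fin n) (Fin n) F) *ᵥ x = p.map x := by
  refine exists_map_eq_mulVec_of_mem_closure (linearMon_closed F n) subset_rfl
    (fun _ _ => rfl) ?_ hM
  rintro N (hN | hN)
  · obtain ⟨p, hp, h⟩ := exists_of_mem_permSet hN
    exact ⟨p, hp.1, h⟩
  · exact exists_of_mem_diagSet hN

lemma map_toLin'_eq_iff {M : Matrix (Fin n) (Fin n) F} {p : SemiMon F n}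
    (h : ∀ x, M *ᵥ x = p.map x) (V W : Submodule F (Fin n → F)) :
    V.map (Matrix.toLin' M) = W ↔ p.act V = W := by
  rw [SemiMon.act_eq_iff, ← SetLike.coe_set_eq, eq_comm]
  have h' : (V.map (Matrix.toLin' M) : Set (Fin n → F)) = p.map '' V := Set.image_congr' h
  rw [h']

lemma permGroup_rel_iff (V W : Submodule F (Fin n → F)) :
    (∃ M ∈ PermGroup F n, V.map (Matrix.toLin' (M : Matrix (Fin n) (Fin n) F)) = W) ↔
      ∃ p ∈ permMon F n, p.act V = W := by
  constructor
  · rintro ⟨M, hM, hVW⟩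
    obtain ⟨p, hp, h⟩ := exists_of_mem_PermGroup hM
    exact ⟨p, hp, (map_toLin'_eq_iff h V W).1 hVW⟩
  · rintro ⟨p, hp, hVW⟩
    obtain ⟨M, hM, h⟩ := exists_mem_PermGroup hp
    exact ⟨M, hM, (map_toLin'_eq_iff h V W).2 hVW⟩

lemma monomialGroup_rel_iff (V W : Submodule F (Fin n → F)) :
    (∃ M ∈ MonomialGroup F n, V.map (Matrix.toLin' (M : Matrix (Fin n) (Fin n) F)) = W) ↔
      ∃ p ∈ linearMon F n, p.act V = W := by
  constructor
  · rintro ⟨M, hM, hVW⟩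
    obtain ⟨p, hp, h⟩ := exists_of_mem_MonomialGroup hM
    exact ⟨p, hp, (map_toLin'_eq_iff h V W).1 hVW⟩
  · rintro ⟨⟨_, π, d⟩, rfl, hVW⟩
    obtain ⟨M, hM, h⟩ := exists_mem_MonomialGroup π d
    exact ⟨M, hM, (map_toLin'_eq_iff h V W).2 hVW⟩

lemma semiRel_iff (V W : Submodule F (Fin n → F)) :
    semiRel F n V W ↔ ∃ p ∈ (Set.univ : Set (SemiMon F n)), p.act V = W := by
  simp only [SemiMon.act_eq_iff]
  constructor
  · rintro ⟨σ, M, hM, hVW⟩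
    obtain ⟨⟨_, π, d⟩, rfl, h⟩ := exists_of_mem_MonomialGroup hM
    refine ⟨(σ, π, d), trivial, ?_⟩
    rw [hVW]
    simp only [h]
    rfl
  · rintro ⟨⟨σ, π, d⟩, _, hVW⟩
    obtain ⟨M, hM, h⟩ := exists_mem_MonomialGroup π d
    refine ⟨σ, M, hM, ?_⟩
    rw [hVW]
    simp only [h]
    rfl

variable (F n)

lemma numClassesDim_permGroup (k : ℕ) :
    numClassesDim F (PermGroup F n) k = orbitsDim (permMon F n) k := by
  simp only [numClassesDim, orbitsDim, permGroup_rel_iff]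

lemma numClasses_permGroup : numClasses F (PermGroup F n) = orbits (permMon F n) := by
  simp only [numClasses, orbits, permGroup_rel_iff]

lemma numClassesDim_monomialGroup (k : ℕ) :
    numClassesDim F (MonomialGroup F n) k = orbitsDim (linearMon F n) k := by
  simp only [numClassesDim, orbitsDim, monomialGroup_rel_iff]

lemma numClasses_monomialGroup : numClasses F (MonomialGroup F n) = orbits (linearMon F n) := by
  simp only [numClasses, orbits, monomialGroup_rel_iff]

lemma numClassesDimSemi_eq (k : ℕ) :
    numClassesDimSemi F n k = orbitsDim (Set.univ : Set (SemiMon F n)) k := by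
  simp only [numClassesDimSemi, orbitsDim, semiRel_iff]

lemma numClassesSemi_eq : numClassesSemi F n = orbits (Set.univ : Set (SemiMon F n)) := by
  simp only [numClassesSemi, orbits, semiRel_iff]

end Groups

section QBinomialAsymptotics

variable {r : ℕ}

lemma KqTrunc_succ (r k : ℕ) :
    KqTrunc r (k + 1) = KqTrunc r k * (1 - (r : ℝ)⁻¹ ^ (k + 1)) := Finset.prod_range_succ _ _

lemma inv_pow_succ_le_half (hr : 1 < r) (k : ℕ) : (r : ℝ)⁻¹ ^ (k + 1) ≤ (1 / 2) ^ (k + 1) := by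
  have hr2 : (2 : ℝ) ≤ r := by exact_mod_cast hr
  rw [one_div]
  gcongr

lemma one_sub_inv_pow_pos (hr : 1 < r) (k : ℕ) : 0 < 1 - (r : ℝ)⁻¹ ^ (k + 1) := by
  have h1 := inv_pow_succ_le_half hr k
  have h2 : (1 / 2 : ℝ) ^ (k + 1) < 1 := pow_lt_one₀ (by norm_num) (by norm_num) k.succ_ne_zero
  linarith

lemma KqTrunc_pos (hr : 1 < r) (k : ℕ) : 0 < KqTrunc r k :=
  Finset.prod_pos fun j _ => one_sub_inv_pow_pos hr j

lemma KqTrunc_antitone (hr : 1 < r) : Antitone (KqTrunc r) := by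
  refine antitone_nat_of_succ_le fun k => ?_
  rw [KqTrunc_succ]
  refine mul_le_of_le_one_right (KqTrunc_pos hr k).le ?_
  have : (0 : ℝ) ≤ (r : ℝ)⁻¹ ^ (k + 1) := by positivity
  linarith

lemma KqTrunc_le_one (hr : 1 < r) (k : ℕ) : KqTrunc r k ≤ 1 := by
  simpa [KqTrunc] using KqTrunc_antitone hr k.zero_le

lemma quarter_le_KqTrunc (hr : 1 < r) (k : ℕ) : 1 / 4 ≤ KqTrunc r k := by
  have key (k : ℕ) : 1 / 4 + (1 / 2 : ℝ) ^ (k + 2) ≤ KqTrunc r (k + 1) := by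
    induction k with
    | zero =>
      have := inv_pow_succ_le_half hr 0
      norm_num [KqTrunc] at *
      linarith
    | succ k ih =>
      rw [KqTrunc_succ]
      have h1 := inv_pow_succ_le_half hr (k + 1)
      have h2 : (1 / 2 : ℝ) ^ (k + 2) ≤ 1 / 4 := by
        have : (1 / 2 : ℝ) ^ k ≤ 1 := pow_le_one₀ (by norm_num) (by norm_num)
        rw [pow_add]
        linarith
      have h3 : (0 : ℝ) < (1 / 2 : ℝ) ^ (k + 2) := by positivity
      have h4 : (1 / 2 : ℝ) ^ (k + 1 + 2) = (1 / 2 : ℝ) ^ (k + 2) / 2 := by ring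
      rw [h4]
      calc 1 / 4 + (1 / 2 : ℝ) ^ (k + 2) / 2
          ≤ (1 / 4 + (1 / 2 : ℝ) ^ (k + 2)) * (1 - (1 / 2 : ℝ) ^ (k + 2)) := by nlinarith
        _ ≤ KqTrunc r (k + 1) * (1 - (r : ℝ)⁻¹ ^ (k + 1 + 1)) :=
          mul_le_mul ih (by linarith) (by linarith) (KqTrunc_pos hr _).le
  cases k with
  | zero => norm_num [KqTrunc]
  | succ k =>
    have := key k
    have : (0 : ℝ) < (1 / 2 : ℝ) ^ (k + 2) := by positivity
    linarith

lemma exists_tendsto_KqTrunc (hr : 1 < r) : ∃ K > 0, Tendsto (KqTrunc r) atTop (𝓝 K) := by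
  have hb : BddBelow (Set.range (KqTrunc r)) :=
    ⟨1 / 4, by rintro _ ⟨k, rfl⟩; exact quarter_le_KqTrunc hr k⟩
  refine ⟨_, ?_, tendsto_atTop_ciInf (KqTrunc_antitone hr) hb⟩
  exact lt_of_lt_of_le (by norm_num) (le_ciInf (quarter_le_KqTrunc hr))

lemma KqTrunc_add (r a b : ℕ) :
    KqTrunc r (a + b) = KqTrunc r a * ∏ j ∈ Finset.range b, (1 - (r : ℝ)⁻¹ ^ (a + j + 1)) :=
  Finset.prod_range_add _ _ _

/-- The ratio between a `q`-binomial coefficient and the corresponding power of `q`. -/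
noncomputable def qBinomRatio (r n k : ℕ) : ℝ := KqTrunc r n / (KqTrunc r k * KqTrunc r (n - k))

lemma qBinom_eq (hr : 1 < r) {n k : ℕ} (hk : k ≤ n) :
    qBinom r n k = qBinomRatio r n k * (r : ℝ) ^ (k * (n - k)) := by
  have hr' : (1 : ℝ) < r := by exact_mod_cast hr
  have hr0 : (r : ℝ) ≠ 0 := by positivity
  obtain ⟨a, rfl⟩ := Nat.exists_eq_add_of_le' hk
  rw [qBinomRatio, Nat.add_sub_cancel, qBinom, KqTrunc_add, mul_comm k a, pow_mul,
    mul_comm (KqTrunc r k), mul_div_mul_left _ _ (KqTrunc_pos hr a).ne', KqTrunc,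
    ← Finset.prod_div_distrib,
    ← Finset.prod_range_reflect (fun j => ((r : ℝ) ^ (a + k - j) - 1) / ((r : ℝ) ^ (k - j) - 1)),
    ← Finset.card_range k, ← Finset.prod_const, Finset.card_range, ← Finset.prod_mul_distrib]
  refine Finset.prod_congr rfl fun j hj => ?_
  have hj := Finset.mem_range.1 hj
  have h1 : a + k - (k - 1 - j) = a + j + 1 := by omega
  have h2 : k - (k - 1 - j) = j + 1 := by omega
  have h3 (e : ℕ) : (r : ℝ) ^ e - 1 = r ^ e * (1 - (r : ℝ)⁻¹ ^ e) := by
    rw [mul_sub, ← mul_pow, mul_inv_cancel₀ hr0, one_pow, mul_one]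
  have h4 := one_sub_inv_pow_pos hr j
  rw [h1, h2, h3, h3, add_assoc, pow_add _ a]
  field_simp

lemma quarter_le_qBinomRatio (hr : 1 < r) (n k : ℕ) : 1 / 4 ≤ qBinomRatio r n k := by
  have h1 := KqTrunc_pos hr k
  have h2 := KqTrunc_pos hr (n - k)
  rw [qBinomRatio, le_div_iff₀ (by positivity)]
  have := mul_le_one₀ (KqTrunc_le_one hr k) h2.le (KqTrunc_le_one hr (n - k))
  linarith [quarter_le_KqTrunc hr n]

lemma qBinomRatio_le (hr : 1 < r) (n k : ℕ) : qBinomRatio r n k ≤ 16 := by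
  have h1 := KqTrunc_pos hr k
  have h2 := KqTrunc_pos hr (n - k)
  rw [qBinomRatio, div_le_iff₀ (by positivity)]
  have := mul_le_mul (quarter_le_KqTrunc hr k) (quarter_le_KqTrunc hr (n - k)) (by norm_num) h1.le
  linarith [KqTrunc_le_one hr n]

lemma tendsto_qBinomRatio {K : ℝ} (hK : 0 < K) (h : Tendsto (KqTrunc r) atTop (𝓝 K))
    {n k : ℕ → ℕ} (hn : Tendsto n atTop atTop) (hk : Tendsto k atTop atTop)
    (hnk : Tendsto (fun m => n m - k m) atTop atTop) :
    Tendsto (fun m => qBinomRatio r (n m) (k m)) atTop (𝓝 K⁻¹) := by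
  have h1 := (h.comp hn).div ((h.comp hk).mul (h.comp hnk)) (by positivity)
  have h2 : K / (K * K) = K⁻¹ := by field_simp
  rw [h2] at h1
  exact h1

lemma rpow_sq_identity (hr : 1 < r) {m k : ℕ} (hk : k ≤ 2 * m + 1) :
    (r : ℝ) ^ (k * (2 * m + 1 - k)) = (r : ℝ) ^ (((2 * m + 1 : ℕ) : ℝ) ^ 2 / 4) *
      (r : ℝ) ^ (-(((m : ℝ) - k + 1 / 2) ^ 2)) := by
  have hr0 : (0 : ℝ) < r := by positivity
  rw [← Real.rpow_add hr0, ← Real.rpow_natCast]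
  congr 1
  push_cast [Nat.cast_sub hk]
  ring

lemma summable_theta2 (hr : 1 < r) :
    Summable fun j : ℤ => ((r : ℝ)⁻¹) ^ (((j : ℝ) + 1 / 2) ^ 2) := by
  have hr' : (1 : ℝ) < r := by exact_mod_cast hr
  have hw0 : 0 < (r : ℝ)⁻¹ := by positivity
  have hw1 : (r : ℝ)⁻¹ < 1 := inv_lt_one_of_one_lt₀ hr'
  have h1 : Summable fun j : ℤ => (r : ℝ)⁻¹ ^ j.natAbs := by
    refine Summable.of_nat_of_neg ?_ ?_ <;>
      simpa using summable_geometric_of_lt_one hw0.le hw1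
  refine Summable.of_nonneg_of_le (fun j => by positivity) (fun j => ?_) (h1.mul_left (r : ℝ))
  have h2 : (r : ℝ) * (r : ℝ)⁻¹ ^ j.natAbs = (r : ℝ)⁻¹ ^ (|(j : ℝ)| - 1) := by
    rw [Real.rpow_sub hw0, Real.rpow_one, div_inv_eq_mul, mul_comm, ← Real.rpow_natCast,
      Nat.cast_natAbs, Int.cast_abs]
  rw [h2]
  refine Real.rpow_le_rpow_of_exponent_ge hw0 hw1.le ?_
  rcases abs_cases (j : ℝ) with ⟨h, _⟩ | ⟨h, _⟩ <;> rw [h] <;> nlinarith [sq_nonneg ((j : ℝ) + 1)]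

lemma theta2_pos (hr : 1 < r) : 0 < theta2 ((r : ℝ))⁻¹ :=
  (summable_theta2 hr).tsum_pos (fun j => by positivity) 0 (by positivity)

lemma Sq_eq_tsum (hr : 1 < r) (m : ℕ) :
    Sq r (2 * m + 1) / (r : ℝ) ^ (((2 * m + 1 : ℕ) : ℝ) ^ 2 / 4) =
      ∑' j : ℤ, if j ∈ Finset.Icc (-(m + 1 : ℤ)) m then
        qBinomRatio r (2 * m + 1) (m - j).toNat * ((r : ℝ)⁻¹) ^ (((j : ℝ) + 1 / 2) ^ 2) else 0 := by
  have hr0 : (0 : ℝ) < r := by positivity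
  rw [tsum_eq_sum (s := Finset.Icc (-(m + 1 : ℤ)) m) fun j hj => if_neg hj, Sq, Finset.sum_div]
  refine Finset.sum_nbij' (fun k => (m : ℤ) - k) (fun j => (m - j).toNat) ?_ ?_ ?_ ?_ ?_
  · intro k hk
    simp only [Finset.mem_range, Finset.mem_Icc] at *
    omega
  · intro k hk
    simp only [Finset.mem_range, Finset.mem_Icc] at *
    omega
  · intro k hk
    simp
  · intro k hk
    simp only [Finset.mem_Icc] at *
    omega
  · intro k hk
    have hk := Finset.mem_range.1 hk
    rw [if_pos (by simp only [Finset.mem_Icc]; omega), qBinom_eq hr (by omega),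
      rpow_sq_identity hr (by omega), Real.inv_rpow hr0.le, ← Real.rpow_neg hr0.le,
      sub_sub_cancel, Int.toNat_natCast]
    push_cast
    field_simp

lemma tendsto_Sq_div (hr : 1 < r) {K : ℝ} (hK : 0 < K) (h : Tendsto (KqTrunc r) atTop (𝓝 K)) :
    Tendsto (fun m : ℕ => Sq r (2 * m + 1) / (r : ℝ) ^ (((2 * m + 1 : ℕ) : ℝ) ^ 2 / 4)) atTop
      (𝓝 (K⁻¹ * theta2 ((r : ℝ))⁻¹)) := by
  simp only [Sq_eq_tsum hr, theta2]
  rw [← tsum_mul_left]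
  refine tendsto_tsum_of_dominated_convergence ((summable_theta2 hr).mul_left 16) ?_ ?_
  · intro j
    have h1 : Tendsto (fun m : ℕ => qBinomRatio r (2 * m + 1) (m - j).toNat) atTop (𝓝 K⁻¹) := by
      refine tendsto_qBinomRatio hK h ?_ ?_ ?_ <;>
        refine tendsto_atTop.2 fun b => ?_ <;>
        filter_upwards [eventually_ge_atTop (b + j.natAbs)] with m hm <;> omega
    refine (h1.mul_const _).congr' ?_
    filter_upwards [eventually_ge_atTop (j.natAbs)] with m hm
    rw [if_pos]
    simp only [Finset.mem_Icc]
    omega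
  · refine Eventually.of_forall fun m j => ?_
    have h2 : 0 ≤ ((r : ℝ)⁻¹) ^ (((j : ℝ) + 1 / 2) ^ 2) := by positivity
    have h3 := quarter_le_qBinomRatio hr (2 * m + 1) (m - j).toNat
    split_ifs
    · rw [Real.norm_of_nonneg (mul_nonneg (by linarith) h2)]
      exact mul_le_mul_of_nonneg_right (qBinomRatio_le hr _ _) h2
    · rw [norm_zero]
      positivity

lemma Sq_pos (hr : 1 < r) (n : ℕ) : 0 < Sq r n :=
  Finset.sum_pos (fun k hk => qBinom_pos hr (by have := Finset.mem_range.1 hk; omega))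
    ⟨0, by simp⟩

lemma tendsto_qBinom_div_Sq (hr : 1 < r) {k : ℕ → ℕ} (hkn : ∀ m, k m ≤ 2 * m + 1)
    (hk : Tendsto k atTop atTop) (hnk : Tendsto (fun m => 2 * m + 1 - k m) atTop atTop) :
    Tendsto (fun m : ℕ => (qBinom r (2 * m + 1) (k m) / Sq r (2 * m + 1)) /
      ((r : ℝ) ^ (-(((m : ℝ) - k m + 1 / 2) ^ 2)) / theta2 ((r : ℝ))⁻¹)) atTop (𝓝 1) := by
  obtain ⟨K, hK, h⟩ := exists_tendsto_KqTrunc hr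
  have hθ := theta2_pos hr
  have hn : Tendsto (fun m : ℕ => 2 * m + 1) atTop atTop :=
    tendsto_atTop.2 fun b => by filter_upwards [eventually_ge_atTop b] with m hm; omega
  have h1 := ((tendsto_qBinomRatio hK h hn hk hnk).mul_const (theta2 ((r : ℝ))⁻¹)).div
    (tendsto_Sq_div hr hK h) (by positivity)
  rw [div_self (by positivity)] at h1
  refine h1.congr fun m => ?_
  have hr0 : (0 : ℝ) < r := by positivity
  have := Sq_pos hr (2 * m + 1)
  rw [Pi.div_apply, qBinom_eq hr (hkn m), rpow_sq_identity hr (hkn m)]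
  generalize theta2 ((r : ℝ))⁻¹ = θ at hθ
  field_simp

end QBinomialAsymptotics

section ErrorTerms

variable {F : Type} [Field F] [Fintype F]

lemma card_semiMon_le (F : Type) [Field F] [Fintype F] (n : ℕ) :
    (Nat.card (SemiMon F n) : ℝ) ≤ Nat.card (F ≃+* F) * ((n : ℝ) * Fintype.card F) ^ n := by
  classical
  have h1 : Nat.card (Equiv.Perm (Fin n)) ≤ n ^ n := by
    rw [Nat.card_eq_fintype_card, Fintype.card_perm, Fintype.card_fin]
    exact Nat.factorial_le_pow n
  have h2 : Nat.card (Fin n → Fˣ) ≤ Fintype.card F ^ n := by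
    rw [Nat.card_fun, Nat.card_eq_fintype_card, Nat.card_eq_fintype_card, Fintype.card_fin]
    exact Nat.pow_le_pow_left (Fintype.card_le_of_injective _ Units.val_injective) n
  rw [SemiMon, Nat.card_prod, Nat.card_prod, mul_pow]
  have h3 := Nat.mul_le_mul_left (Nat.card (F ≃+* F)) (Nat.mul_le_mul h1 h2)
  exact_mod_cast h3

/-- A polynomial times a decaying exponential tends to zero. -/
lemma tendsto_pow_mul_rpow_neg {r : ℝ} (hr : 1 < r) (c : ℝ) (i : ℕ) {e : ℝ} (he : 0 < e) :
    Tendsto (fun n : ℕ => c * (n : ℝ) ^ i * r ^ (-((n : ℝ) / e))) atTop (𝓝 0) := by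
  have hr0 : 0 < r := by linarith
  have h1 : r ^ (-(1 / e)) < 1 := Real.rpow_lt_one_of_one_lt_of_neg hr (by simpa using he)
  have h2 := (tendsto_pow_const_mul_const_pow_of_abs_lt_one (r := r ^ (-(1 / e))) i
    (by rwa [abs_of_pos (by positivity)])).const_mul c
  rw [mul_zero] at h2
  refine h2.congr fun n => ?_
  rw [mul_assoc, ← Real.rpow_natCast (r ^ _), ← Real.rpow_mul hr0.le]
  ring_nf

/-- The superexponentially small quantity controlling the error terms. -/
lemma tendsto_superexponential {r : ℝ} (hr : 1 < r) (C : ℝ) {e : ℝ} (he : 0 < e) :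
    Tendsto (fun n : ℕ => C * (n + 1) * ((n : ℝ) * r * r ^ (-((n : ℝ) / e))) ^ n) atTop (𝓝 0) := by
  have h1 : Tendsto (fun n : ℕ => (n : ℝ) * r * r ^ (-((n : ℝ) / e))) atTop (𝓝 0) := by
    refine (tendsto_pow_mul_rpow_neg hr r 1 he).congr fun n => ?_
    ring
  have h2 : Tendsto (fun n : ℕ => |C| * ((n : ℝ) ^ 1 * (1 / 2 : ℝ) ^ n + (1 / 2 : ℝ) ^ n)) atTop
      (𝓝 0) := by
    have h3 := (tendsto_pow_const_mul_const_pow_of_abs_lt_one (r := (1 / 2 : ℝ)) 1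
      (by rw [abs_of_pos] <;> norm_num)).add
      (tendsto_pow_atTop_nhds_zero_of_lt_one (r := (1 / 2 : ℝ)) (by norm_num) (by norm_num))
    simpa using h3.const_mul |C|
  refine squeeze_zero_norm' ?_ h2
  filter_upwards [h1.eventually_le_const (show (0 : ℝ) < 1 / 2 by norm_num)] with n hn
  have h0 : 0 ≤ (n : ℝ) * r * r ^ (-((n : ℝ) / e)) := by positivity
  rw [Real.norm_eq_abs, abs_mul, abs_mul, abs_of_nonneg (show (0 : ℝ) ≤ n + 1 by positivity),
    abs_of_nonneg (pow_nonneg h0 n), mul_assoc]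
  refine mul_le_mul_of_nonneg_left ?_ (abs_nonneg C)
  rw [pow_one, ← add_one_mul]
  exact mul_le_mul_of_nonneg_left (pow_le_pow_left₀ h0 hn n) (by positivity)

lemma tendsto_fixError (F : Type) [Field F] [Fintype F] :
    Tendsto (fun n => fixError F n (n / 16)) atTop (𝓝 0) := by
  have hq := one_lt_cast_card F
  have hq0 : (0 : ℝ) < Fintype.card F := by linarith
  set q : ℝ := (Fintype.card F : ℝ)
  rw [show (0 : ℝ) = 0 + 0 by simp]
  refine Tendsto.add ?_ ?_
  · refine squeeze_zero' (Eventually.of_forall fun n => by positivity) ?_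
      (tendsto_superexponential hq (Nat.card (F ≃+* F)) (e := 512) (by norm_num))
    filter_upwards [eventually_ge_atTop 48] with n hn
    have hJ : (n : ℝ) / 32 ≤ ((n / 16 : ℕ) : ℝ) := by
      rw [div_le_iff₀ (by norm_num)]
      exact_mod_cast (by omega : n ≤ n / 16 * 32)
    have hJ' : ((n / 16 : ℕ) : ℝ) ≤ (n : ℝ) / 16 := by
      rw [le_div_iff₀ (by norm_num)]
      exact_mod_cast (by omega : n / 16 * 16 ≤ n)
    have hn' : (48 : ℝ) ≤ n := by exact_mod_cast hn
    have h1 : (q ^ (3 + 2 * ((n / 16 : ℕ) : ℝ) - (n : ℝ) / 4)) ^ (n / 16)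
        ≤ (q ^ (-((n : ℝ) / 512))) ^ n := by
      rw [← Real.rpow_natCast, ← Real.rpow_natCast, ← Real.rpow_mul hq0.le,
        ← Real.rpow_mul hq0.le]
      refine Real.rpow_le_rpow_of_exponent_le hq.le ?_
      nlinarith
    calc (Nat.card (SemiMon F n) : ℝ) * (q ^ (3 + 2 * ((n / 16 : ℕ) : ℝ) - (n : ℝ) / 4)) ^ (n / 16)
        ≤ (Nat.card (F ≃+* F) * ((n : ℝ) * q) ^ n) * (q ^ (-((n : ℝ) / 512))) ^ n := by
          gcongr
          exact card_semiMon_le F n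
      _ = Nat.card (F ≃+* F) * 1 * ((n : ℝ) * q * q ^ (-((n : ℝ) / 512))) ^ n := by
          rw [mul_pow _ (q ^ _)]
          ring
      _ ≤ _ := by
          gcongr
          linarith
  · have h1 : Tendsto (fun n : ℕ => q * (2 * (Real.exp (q * (n : ℝ) ^ 2 * q ^ (-((n : ℝ) / 32))) - 1)))
        atTop (𝓝 0) := by
      have h2 := (Real.continuous_exp.tendsto 0).comp
        (tendsto_pow_mul_rpow_neg hq q 2 (e := 32) (by norm_num))
      simpa using ((h2.sub_const 1).const_mul 2).const_mul q
    refine squeeze_zero (fun n => ?_) (fun n => ?_) h1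
    · refine mul_nonneg hq0.le (mul_nonneg zero_le_two (sub_nonneg.2 (one_le_pow₀ ?_)))
      exact le_add_of_nonneg_right (by positivity)
    · have h3 : 0 ≤ (n : ℝ) * q * q ^ (-((n : ℝ) / 32)) := by positivity
      have h4 : (1 + (n : ℝ) * q * q ^ (-((n : ℝ) / 32))) ^ n
          ≤ Real.exp (q * (n : ℝ) ^ 2 * q ^ (-((n : ℝ) / 32))) := by
        calc (1 + (n : ℝ) * q * q ^ (-((n : ℝ) / 32))) ^ n
            ≤ Real.exp ((n : ℝ) * q * q ^ (-((n : ℝ) / 32))) ^ n := by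
              gcongr
              rw [add_comm]
              exact Real.add_one_le_exp _
          _ = _ := by
              rw [← Real.exp_nat_mul]
              ring_nf
      gcongr

lemma le_Sq {r : ℕ} (hr : 1 < r) (n : ℕ) :
    (r : ℝ) ^ ((n : ℝ) ^ 2 / 4 - 1 / 4) / 4 ≤ Sq r n := by
  have hr' : (1 : ℝ) < r := by exact_mod_cast hr
  have h1 : qBinom r n (n / 2) ≤ Sq r n :=
    Finset.single_le_sum (f := fun k => qBinom r n k)
      (fun k hk => (qBinom_pos hr (by have := Finset.mem_range.1 hk; omega)).le)
      (Finset.mem_range.2 (by omega))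
  refine le_trans ?_ h1
  rw [qBinom_eq hr (by omega)]
  have h2 := quarter_le_qBinomRatio hr n (n / 2)
  have h3 : (r : ℝ) ^ ((n : ℝ) ^ 2 / 4 - 1 / 4) ≤ (r : ℝ) ^ (n / 2 * (n - n / 2)) := by
    rw [← Real.rpow_natCast (r : ℝ)]
    refine Real.rpow_le_rpow_of_exponent_le hr'.le ?_
    have h4 : n * n ≤ 4 * (n / 2 * (n - n / 2)) + 1 := by
      rcases Nat.even_or_odd' n with ⟨m, rfl | rfl⟩
      · rw [show 2 * m / 2 = m by omega, show 2 * m - m = m by omega]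
        nlinarith
      · rw [show (2 * m + 1) / 2 = m by omega, show 2 * m + 1 - m = m + 1 by omega]
        nlinarith
    have h5 : (n : ℝ) * n ≤ 4 * ((n / 2 * (n - n / 2) : ℕ) : ℝ) + 1 := by exact_mod_cast h4
    linarith
  calc (r : ℝ) ^ ((n : ℝ) ^ 2 / 4 - 1 / 4) / 4
      = 1 / 4 * (r : ℝ) ^ ((n : ℝ) ^ 2 / 4 - 1 / 4) := by ring
    _ ≤ _ := mul_le_mul h2 h3 (by positivity) (by linarith)

/-- Away from the middle dimensions there are comparatively few subspaces. -/
lemma qBinom_le_of_not_middle {r : ℕ} (hr : 1 < r) {n k : ℕ} (hk : k ≤ n)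
    (h : ¬ (3 * n ≤ 8 * k ∧ 8 * k ≤ 5 * n)) :
    qBinom r n k ≤ 64 * r * (r : ℝ) ^ (-((n : ℝ) ^ 2 / 64)) * Sq r n := by
  have hr' : (1 : ℝ) < r := by exact_mod_cast hr
  have hr0 : (0 : ℝ) < r := by linarith
  have h1 : (r : ℝ) ^ (k * (n - k)) ≤ (r : ℝ) ^ ((n : ℝ) ^ 2 / 4 - (n : ℝ) ^ 2 / 64) := by
    rw [← Real.rpow_natCast]
    refine Real.rpow_le_rpow_of_exponent_le hr'.le ?_
    have hn0 : (0 : ℝ) ≤ n := by positivity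
    have hk0 : (0 : ℝ) ≤ k := by positivity
    push_cast [Nat.cast_sub hk]
    rw [not_and_or, not_le, not_le] at h
    rcases h with h | h
    · have h' : 8 * (k : ℝ) ≤ 3 * n := by exact_mod_cast h.le
      nlinarith
    · have h' : 5 * (n : ℝ) ≤ 8 * k := by exact_mod_cast h.le
      nlinarith
  have h2 : (r : ℝ) ^ ((n : ℝ) ^ 2 / 4 - (n : ℝ) ^ 2 / 64)
      ≤ r * (r : ℝ) ^ (-((n : ℝ) ^ 2 / 64)) * (r : ℝ) ^ ((n : ℝ) ^ 2 / 4 - 1 / 4) := by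
    nth_rewrite 2 [← Real.rpow_one (r : ℝ)]
    rw [← Real.rpow_add hr0, ← Real.rpow_add hr0]
    exact Real.rpow_le_rpow_of_exponent_le hr'.le (by linarith)
  have h3 := le_Sq hr n
  rw [qBinom_eq hr hk]
  calc qBinomRatio r n k * (r : ℝ) ^ (k * (n - k))
      ≤ 16 * (r * (r : ℝ) ^ (-((n : ℝ) ^ 2 / 64)) * (r : ℝ) ^ ((n : ℝ) ^ 2 / 4 - 1 / 4)) :=
        mul_le_mul (qBinomRatio_le hr n k) (h1.trans h2) (by positivity) (by norm_num)
    _ = 64 * r * (r : ℝ) ^ (-((n : ℝ) ^ 2 / 64)) * ((r : ℝ) ^ ((n : ℝ) ^ 2 / 4 - 1 / 4) / 4) := by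
        ring
    _ ≤ _ := mul_le_mul_of_nonneg_left h3 (by positivity)

/-- The subspaces fixed by non-scalar transformations are negligible. -/
lemma exists_fixTotal_le (F : Type) [Field F] [Fintype F] :
    ∃ e : ℕ → ℝ, Tendsto e atTop (𝓝 0) ∧ ∀ n, 2 ≤ n →
      (∀ k, 3 * n ≤ 8 * k → 8 * k ≤ 5 * n →
        fixTotal F n k ≤ e n * qBinom (Fintype.card F) n k) ∧
      ∑ k ∈ Finset.range (n + 1), fixTotal F n k ≤ e n * Sq (Fintype.card F) n := by
  have hr : 1 < Fintype.card F := Fintype.one_lt_card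
  have hq := one_lt_cast_card F
  have hq0 : (0 : ℝ) < Fintype.card F := by linarith
  set C : ℝ := Nat.card (F ≃+* F) * (64 * Fintype.card F) with hC
  set e₁ : ℕ → ℝ := fun n => fixError F n (n / 16) with he₁
  set e₂ : ℕ → ℝ := fun n => C * (n + 1) *
    ((n : ℝ) * Fintype.card F * (Fintype.card F : ℝ) ^ (-((n : ℝ) / 64))) ^ n with he₂
  have he₁0 (n : ℕ) : 0 ≤ e₁ n := by
    refine add_nonneg (by positivity) (mul_nonneg hq0.le (mul_nonneg zero_le_two
      (sub_nonneg.2 (one_le_pow₀ (le_add_of_nonneg_right (by positivity))))))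
  have he₂0 (n : ℕ) : 0 ≤ e₂ n := by positivity
  refine ⟨fun n => e₁ n + e₂ n, ?_, fun n hn => ⟨fun k hk1 hk2 => ?_, ?_⟩⟩
  · simpa using (tendsto_fixError F).add (tendsto_superexponential hq C (e := 64) (by norm_num))
  · have hg := qBinom_pos (r := Fintype.card F) (n := n) (k := k) hr (by omega)
    refine (fixTotal_le_of_middle hn hk1 hk2 (n / 16)).trans ?_
    rw [mul_comm]
    exact mul_le_mul_of_nonneg_right (le_add_of_nonneg_right (he₂0 n)) hg.le
  · have hS := Sq_pos hr n
    have h1 (k : ℕ) (hk : k ∈ Finset.range (n + 1)) : fixTotal F n k ≤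
        e₁ n * qBinom (Fintype.card F) n k + e₂ n * Sq (Fintype.card F) n / (n + 1) := by
      have hk : k ≤ n := by have := Finset.mem_range.1 hk; omega
      have hg := qBinom_pos (r := Fintype.card F) (n := n) (k := k) hr hk
      by_cases hm : 3 * n ≤ 8 * k ∧ 8 * k ≤ 5 * n
      · refine (fixTotal_le_of_middle hn hm.1 hm.2 (n / 16)).trans ?_
        rw [mul_comm]
        exact le_add_of_nonneg_right (div_nonneg (mul_nonneg (he₂0 n) hS.le) (by positivity))
      · refine le_trans ?_ (le_add_of_nonneg_left (mul_nonneg (he₁0 n) hg.le))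
        have hx : (Fintype.card F : ℝ) ^ (-((n : ℝ) ^ 2 / 64))
            = ((Fintype.card F : ℝ) ^ (-((n : ℝ) / 64))) ^ n := by
          rw [← Real.rpow_natCast ((Fintype.card F : ℝ) ^ _), ← Real.rpow_mul hq0.le]
          ring_nf
        calc fixTotal F n k
            ≤ Nat.card (SemiMon F n) * qBinom (Fintype.card F) n k := fixTotal_le hk
          _ ≤ (Nat.card (F ≃+* F) * ((n : ℝ) * Fintype.card F) ^ n) *
              (64 * Fintype.card F * (Fintype.card F : ℝ) ^ (-((n : ℝ) ^ 2 / 64)) *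
                Sq (Fintype.card F) n) :=
              mul_le_mul (card_semiMon_le F n) (qBinom_le_of_not_middle hr hk hm) hg.le
                (by positivity)
          _ = _ := by
              rw [hx]
              simp only [he₂, hC]
              rw [mul_pow _ ((Fintype.card F : ℝ) ^ _)]
              field_simp
    refine (Finset.sum_le_sum h1).trans (le_of_eq ?_)
    rw [Finset.sum_add_distrib, ← Finset.mul_sum, Finset.sum_const, Finset.card_range,
      nsmul_eq_mul, add_mul, Sq]
    push_cast
    field_simp

end ErrorTerms

section Main

variable {F : Type} [Field F] [Fintype F]

/-- Condition (⋆) forces the dimension to be close to half of the length. -/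
lemma StarCond.eventually {k : ℕ → ℕ} (h : StarCond 1 1 k) :
    ∀ᶠ n : ℕ in atTop, ((n : ℝ) / 2 - k n) ^ 2 ≤ n := by
  filter_upwards [h.eventually_le_atBot 0] with n hn
  have := Real.sqrt_nonneg (n : ℝ)
  nlinarith

/-- Orbits are asymptotically distributed over the dimensions as subspaces are. -/
lemma tendsto_orbits_ratio (P : ∀ n, Set (SemiMon F n)) (hP : ∀ n, SemiMonClosed (P n))
    {k : ℕ → ℕ} (hk : ∀ᶠ n in atTop, 3 * n ≤ 8 * k n ∧ 8 * k n ≤ 5 * n) :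
    Tendsto (fun n => ((orbitsDim (P n) (k n) : ℝ) / orbits (P n)) /
      (qBinom (Fintype.card F) n (k n) / Sq (Fintype.card F) n)) atTop (𝓝 1) := by
  obtain ⟨e, he, hfix⟩ := exists_fixTotal_le F
  have hr : 1 < Fintype.card F := Fintype.one_lt_card
  have hu : Tendsto (fun n => 1 + e n) atTop (𝓝 1) := by simpa using he.const_add 1
  have hl : Tendsto (fun n => (1 + e n)⁻¹) atTop (𝓝 1) := by simpa using hu.inv₀ one_ne_zero
  have key : ∀ᶠ n in atTop,
      (1 + e n)⁻¹ ≤ ((orbitsDim (P n) (k n) : ℝ) / orbits (P n)) /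
        (qBinom (Fintype.card F) n (k n) / Sq (Fintype.card F) n) ∧
      ((orbitsDim (P n) (k n) : ℝ) / orbits (P n)) /
        (qBinom (Fintype.card F) n (k n) / Sq (Fintype.card F) n) ≤ 1 + e n := by
    filter_upwards [hk, eventually_ge_atTop 2, he.eventually_const_lt (show (-1 : ℝ) < 0 by simp)]
      with n hkn hn hen
    obtain ⟨h1, h2⟩ := hfix n hn
    have hc : (0 : ℝ) < Nat.card (hP n).subgroup := by exact_mod_cast Nat.card_pos
    obtain ⟨h3, h4⟩ := (hP n).orbitsDim_bounds (show k n ≤ n by omega)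
    replace h4 := h4.trans (add_le_add_right (h1 _ hkn.1 hkn.2) _)
    have h5 : Nat.card (hP n).subgroup * (orbits (P n) : ℝ)
        = ∑ j ∈ Finset.range (n + 1), Nat.card (hP n).subgroup * (orbitsDim (P n) j : ℝ) := by
      rw [(hP n).orbits_eq_sum, Nat.cast_sum, Finset.mul_sum]
    have h6 : Sq (Fintype.card F) n ≤ Nat.card (hP n).subgroup * (orbits (P n) : ℝ) := by
      rw [h5]
      exact Finset.sum_le_sum fun j hj =>
        ((hP n).orbitsDim_bounds (by have := Finset.mem_range.1 hj; omega)).1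
    have h7 : Nat.card (hP n).subgroup * (orbits (P n) : ℝ)
        ≤ Sq (Fintype.card F) n + e n * Sq (Fintype.card F) n := by
      refine le_trans ?_ (add_le_add_right h2 _)
      rw [h5, Sq, ← Finset.sum_add_distrib]
      exact Finset.sum_le_sum fun j hj =>
        ((hP n).orbitsDim_bounds (by have := Finset.mem_range.1 hj; omega)).2
    have hg := qBinom_pos (r := Fintype.card F) (n := n) (k := k n) hr (by omega)
    have hS := Sq_pos hr n
    have he0 : 0 < 1 + e n := by linarith
    rw [← mul_div_mul_left (orbitsDim (P n) (k n) : ℝ) _ hc.ne']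
    generalize (Nat.card (hP n).subgroup : ℝ) * (orbitsDim (P n) (k n) : ℝ) = x at *
    generalize (Nat.card (hP n).subgroup : ℝ) * (orbits (P n) : ℝ) = y at *
    have hy : 0 < y := hS.trans_le h6
    rw [div_div_div_eq]
    constructor
    · rw [le_div_iff₀ (by positivity), inv_mul_le_iff₀ he0]
      calc y * qBinom (Fintype.card F) n (k n)
          ≤ ((1 + e n) * Sq (Fintype.card F) n) * x :=
            mul_le_mul (by linarith) h3 hg.le (by positivity)
        _ = _ := by ring
    · rw [div_le_iff₀ (by positivity)]
      calc x * Sq (Fintype.card F) n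
          ≤ ((1 + e n) * qBinom (Fintype.card F) n (k n)) * y :=
            mul_le_mul (by linarith) h6 hS.le (by positivity)
        _ = _ := by ring
  exact tendsto_of_tendsto_of_tendsto_of_le_of_le' hl hu (key.mono fun _ h => h.1)
    (key.mono fun _ h => h.2)

lemma tendsto_orbits_theta2 (P : ∀ n, Set (SemiMon F n)) (hP : ∀ n, SemiMonClosed (P n))
    {k : ℕ → ℕ} (hkn : ∀ n, k n ≤ n) (hk : StarCond 1 1 k) :
    Tendsto (fun m : ℕ =>
      ((orbitsDim (P (2 * m + 1)) (k (2 * m + 1)) : ℝ) / orbits (P (2 * m + 1))) /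
        ((Fintype.card F : ℝ) ^ (-(((m : ℝ) - (k (2 * m + 1) : ℝ) + 1 / 2) ^ 2)) /
          theta2 ((Fintype.card F : ℝ))⁻¹)) atTop (𝓝 1) := by
  have hr : 1 < Fintype.card F := Fintype.one_lt_card
  have hm : ∀ᶠ n in atTop, 3 * n ≤ 8 * k n ∧ 8 * k n ≤ 5 * n := by
    filter_upwards [hk.eventually, eventually_ge_atTop 64] with n h hn
    have hn' : (64 : ℝ) ≤ n := by exact_mod_cast hn
    have h1 := abs_le_of_sq_le_sq' (a := (n : ℝ) / 2 - k n) (b := (n : ℝ) / 8)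
      (h.trans (by nlinarith)) (by positivity)
    constructor
    · have : 3 * (n : ℝ) ≤ 8 * k n := by linarith [h1.2]
      exact_mod_cast this
    · have : 8 * (k n : ℝ) ≤ 5 * n := by linarith [h1.1]
      exact_mod_cast this
  have hodd : Tendsto (fun m : ℕ => 2 * m + 1) atTop atTop :=
    tendsto_atTop.2 fun b => by filter_upwards [eventually_ge_atTop b] with m hm; omega
  have h1 := (tendsto_orbits_ratio P hP hm).comp hodd
  have h2 := tendsto_qBinom_div_Sq hr (fun m => hkn (2 * m + 1))
    (tendsto_atTop.2 fun b => by
      filter_upwards [hodd.eventually hm, eventually_ge_atTop (2 * b)] with m h hb; omega)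
    (tendsto_atTop.2 fun b => by
      filter_upwards [hodd.eventually hm, eventually_ge_atTop (2 * b)] with m h hb; omega)
  have h3 := h1.mul h2
  rw [one_mul] at h3
  refine h3.congr fun m => ?_
  have hg := qBinom_pos hr (hkn (2 * m + 1))
  have hS := Sq_pos hr (2 * m + 1)
  exact div_mul_div_cancel₀ (div_pos hg hS).ne'

end Main

theorem stmt17 (q p h : ℕ) (hp : p.Prime) (hh : 1 ≤ h) (hqph : q = p ^ h)
    (F : Type) [Field F] [Fintype F] (hq : Fintype.card F = q) :
    ∃ A > (0 : ℝ), ∃ ε > (0 : ℝ), ∀ k : ℕ → ℕ, (∀ n, k n ≤ n) → StarCond A ε k →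
      (Tendsto (fun m : ℕ =>
          ((numClassesDim F (PermGroup F (2 * m + 1)) (k (2 * m + 1)) : ℝ) /
            (numClasses F (PermGroup F (2 * m + 1)) : ℝ)) /
          ((q : ℝ) ^ (-(((m : ℝ) - (k (2 * m + 1) : ℝ) + 1 / 2) ^ 2)) / theta2 ((q : ℝ))⁻¹))
        atTop (𝓝 1)) ∧
      (Tendsto (fun m : ℕ =>
          ((numClassesDim F (MonomialGroup F (2 * m + 1)) (k (2 * m + 1)) : ℝ) /
            (numClasses F (MonomialGroup F (2 * m + 1)) : ℝ)) /
          ((q : ℝ) ^ (-(((m : ℝ) - (k (2 * m + 1) : ℝ) + 1 / 2) ^ 2)) / theta2 ((q : ℝ))⁻¹))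
        atTop (𝓝 1)) ∧
      (Tendsto (fun m : ℕ =>
          ((numClassesDimSemi F (2 * m + 1) (k (2 * m + 1)) : ℝ) /
            (numClassesSemi F (2 * m + 1) : ℝ)) /
          ((q : ℝ) ^ (-(((m : ℝ) - (k (2 * m + 1) : ℝ) + 1 / 2) ^ 2)) / theta2 ((q : ℝ))⁻¹))
        atTop (𝓝 1)) := by
  subst hq
  refine ⟨1, one_pos, 1, one_pos, fun k hkn hk => ⟨?_, ?_, ?_⟩⟩
  · simp only [numClassesDim_permGroup, numClasses_permGroup]
    exact tendsto_orbits_theta2 _ (permMon_closed F) hkn hk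
  · simp only [numClassesDim_monomialGroup, numClasses_monomialGroup]
    exact tendsto_orbits_theta2 _ (linearMon_closed F) hkn hk
  · simp only [numClassesDimSemi_eq, numClassesSemi_eq]
    exact tendsto_orbits_theta2 _ (univ_closed F) hkn hk
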